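/- arXiv:1608.06401 — 2 statements merged into one kernel-verified Lean document; each statement's English description precedes it below -/
import Mathlib

section
/- Let d ≥ 2. For every ε > 0 there exist δ > 0 and q₀ such that for every odd prime power q ≥ q₀, every non-degenerate quadratic form Q on F_q^d, every E ⊆ F_q^d and every even integer k ≥ 2: if q^{(d+1)/2}·Λ_k(E) ≤ δ·|E|^k, then for every t ∈ F_q∖{0} one has |ν_k(t) − |E|^k/q| ≤ ε·|E|^k/q. -/
open Finset

/-- The `k`-energy `Λ_k(E)` of a set `E` (intended for even `k = 2m`): the number of
`k`-tuples from `E` whose first `k/2` entries and last `k/2` entries have equal sums. -/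
noncomputable def energy {G : Type} [AddCommMonoid G] (E : Finset G) (k : ℕ) : ℕ :=
  Nat.card {x : Fin k → G // (∀ i, x i ∈ E) ∧
    (∑ i ∈ Finset.univ.filter (fun i : Fin k => (i : ℕ) < k / 2), x i) =
    (∑ i ∈ Finset.univ.filter (fun i : Fin k => ¬ (i : ℕ) < k / 2), x i)}

/-- `ν_k(t)`: the number of `k`-tuples from `E` whose sum lies on the level set `Q = t`. -/
noncomputable def nuQ {F : Type} [Field F] [Fintype F] {d : ℕ}
    (Q : QuadraticForm F (Fin d → F)) (E : Finset (Fin d → F)) (k : ℕ) (t : F) : ℕ :=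
  Nat.card {x : Fin k → (Fin d → F) // (∀ i, x i ∈ E) ∧ Q (∑ i, x i) = t}

open Polynomial in
/-- The Stepanov method: an auxiliary polynomial vanishing on `S` bounds the number of points
satisfying a relation between `w` and its Frobenius power. -/
theorem card_le_of_frobenius_relation {k : Type} [Field k] [Fintype k] {p m q N : ℕ} [Fact p.Prime]
    [CharP k p] (hq : 3 ≤ q) (hN : 1 ≤ N) (hP : q * N = p ^ m)
    (hk : Fintype.card k = (q * N) ^ 2) (w : k[X]) (hw : w.Monic) (hwd : w.natDegree = 2 * N)
    (τ : k) (S : Finset k) (hS : ∀ x ∈ S, x ≠ 0 ∧ w.eval x ^ (q * N) * x ^ N =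
      x ^ (N * (q * N)) * (τ * x ^ N - w.eval x)) :
    S.card ≤ N * (q * N) + 5 * (q * N) := by
  classical
  let ι := Fin q × Fin (N + 3) × Fin N
  let T : ι → k[X] := fun t => X ^ ((t.2.2 : ℕ) * (q * N) + t.2.1 + (q - 1 - t.1) * N) *
    (C τ * X ^ N - w) ^ (t.1 : ℕ)
  let V : ι → k[X] := fun t => X ^ ((t.2.2 : ℕ) + t.2.1 * (q * N) + (q - 1 - t.1) * N) *
    w ^ (t.1 : ℕ)
  have hwc : (C τ * X ^ N - w).natDegree ≤ 2 * N := by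
    refine (natDegree_sub_le _ _).trans (max_le ?_ hwd.le)
    exact (natDegree_C_mul_X_pow_le _ _).trans (by omega)
  obtain ⟨q', rfl⟩ : ∃ q', q = q' + 1 := ⟨q - 1, by omega⟩
  have hT : ∀ t, T t ∈ degreeLT k ((N + 1) * ((q' + 1) * N) + N + 3) := by
    intro t
    rw [mem_degreeLT]
    refine lt_of_le_of_lt degree_le_natDegree ?_
    rw [Nat.cast_lt]
    have h1 : (T t).natDegree ≤
        ((t.2.2 : ℕ) * ((q' + 1) * N) + t.2.1 + (q' - t.1) * N) + t.1 * (2 * N) := by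
      refine natDegree_mul_le.trans (add_le_add (natDegree_X_pow_le _) ?_)
      exact natDegree_pow_le.trans (Nat.mul_le_mul_left _ hwc)
    obtain ⟨⟨i, hi⟩, ⟨j, hj⟩, ⟨l, hl⟩⟩ := t
    simp only at h1
    obtain ⟨c, rfl⟩ : ∃ c, q' = i + c := ⟨q' - i, by omega⟩
    obtain ⟨b, rfl⟩ : ∃ b, N = l + 1 + b := ⟨N - l - 1, by omega⟩
    rw [Nat.add_sub_cancel_left] at h1
    refine lt_of_le_of_lt h1 ?_
    nlinarith [Nat.zero_le (b * ((i + c + 1) * (l+1+b))), Nat.zero_le (c * (l + 1 + b))]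
  obtain ⟨c, hc0, hcT⟩ : ∃ c : ι → k, c ≠ 0 ∧ ∑ t, c t • T t = 0 := by
    let Ψ : (ι → k) →ₗ[k] degreeLT k ((N + 1) * ((q' + 1) * N) + N + 3) :=
      Fintype.linearCombination k (fun t => ⟨T t, hT t⟩)
    have hfd : Module.finrank k (degreeLT k ((N + 1) * ((q' + 1) * N) + N + 3)) =
        (N + 1) * ((q' + 1) * N) + N + 3 := by
      rw [(degreeLTEquiv k _).finrank_eq, Module.finrank_fin_fun]
    have : FiniteDimensional k (degreeLT k ((N + 1) * ((q' + 1) * N) + N + 3)) :=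
      (degreeLTEquiv k _).symm.finiteDimensional
    have hker : LinearMap.ker Ψ ≠ ⊥ := by
      apply LinearMap.ker_ne_bot_of_finrank_lt
      rw [hfd, Module.finrank_fintype_fun_eq_card]
      simp only [ι, Fintype.card_prod, Fintype.card_fin]
      nlinarith
    obtain ⟨c, hc, hc0⟩ := (Submodule.ne_bot_iff _).1 hker
    refine ⟨c, hc0, ?_⟩
    have := congrArg Subtype.val (LinearMap.mem_ker.1 hc)
    simpa [Ψ, Fintype.linearCombination_apply] using this
  choose b hb using fun t => (bijective_iterateFrobenius (R := k) (p := p) (n := m)).2 (c t)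
  simp only [iterateFrobenius_def] at hb
  have hVm : ∀ t, (V t).Monic := fun t => (monic_X_pow _).mul (hw.pow _)
  have hVd : ∀ t, (V t).natDegree = (t.2.2 : ℕ) + t.1 * N + t.2.1 * ((q' + 1) * N) + q' * N := by
    intro t
    rw [(monic_X_pow _).natDegree_mul (hw.pow _), natDegree_X_pow, hw.natDegree_pow, hwd]
    obtain ⟨⟨i, hi⟩, ⟨j, hj⟩, ⟨l, hl⟩⟩ := t
    obtain ⟨c, rfl⟩ : ∃ c, q' = i + c := ⟨q' - i, by omega⟩
    simp only [Nat.add_sub_cancel, Nat.add_sub_cancel_left]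
    ring
  have hVinj : ∀ t t' : ι, (V t).natDegree = (V t').natDegree → t = t' := by
    intro t t' h
    rw [hVd, hVd] at h
    obtain ⟨⟨i, hi⟩, ⟨j, hj⟩, ⟨l, hl⟩⟩ := t
    obtain ⟨⟨i', hi'⟩, ⟨j', hj'⟩, ⟨l', hl'⟩⟩ := t'
    simp only at h
    have e1 : l + N * (i + (q' + 1) * j) = l' + N * (i' + (q' + 1) * j') := by linarith
    have e2 : l = l' := by
      have := congrArg (· % N) e1
      simpa [Nat.add_mul_mod_self_left, Nat.mod_eq_of_lt hl, Nat.mod_eq_of_lt hl'] using this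
    subst e2
    have e3 : i + (q' + 1) * j = i' + (q' + 1) * j' :=
      Nat.eq_of_mul_eq_mul_left hN (by omega)
    have e4 : i = i' := by
      have := congrArg (· % (q' + 1)) e3
      simpa [Nat.add_mul_mod_self_left, Nat.mod_eq_of_lt hi, Nat.mod_eq_of_lt hi'] using this
    subst e4
    have e5 : j = j' := Nat.eq_of_mul_eq_mul_left (show 0 < q' + 1 by omega) (by omega)
    subst e5
    rfl
  let U : k[X] := ∑ t, b t • V t
  have hU0 : U ≠ 0 := by
    obtain ⟨t₀, ht₀⟩ := Function.ne_iff.1 hc0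
    have hb0 : b t₀ ≠ 0 := by
      intro h
      apply ht₀
      rw [← hb, h, zero_pow (by rw [← hP]; positivity)]
      rfl
    have hd : U.degree = univ.sup fun t => (b t • V t).degree := by
      apply degree_sum_eq_of_disjoint
      rintro t ⟨-, ht⟩ t' ⟨-, ht'⟩ hne heq
      apply hne
      apply hVinj
      have hbt : b t ≠ 0 := fun h => ht (by simp [h])
      have hbt' : b t' ≠ 0 := fun h => ht' (by simp [h])
      have := natDegree_eq_of_degree_eq heq
      simpa [natDegree_smul _ hbt, natDegree_smul _ hbt'] using this
    intro h0
    rw [h0, degree_zero] at hd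
    have h1 : (b t₀ • V t₀).degree ≤ ⊥ := by
      rw [hd]
      exact Finset.le_sup (f := fun t => (b t • V t).degree) (mem_univ t₀)
    have h2 := degree_eq_bot.1 (le_bot_iff.1 h1)
    exact (smul_ne_zero hb0 (hVm t₀).ne_zero) h2
  have hroot : ∀ x ∈ S, U.eval x = 0 := by
    intro x hx
    obtain ⟨hx0, hxw⟩ := hS x hx
    have hxP : (x ^ ((q' + 1) * N)) ^ ((q' + 1) * N) = x := by
      rw [← pow_mul, ← sq, ← hk, FiniteField.pow_card]
    have key : U.eval x ^ ((q' + 1) * N) * x ^ (q' * N) =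
        x ^ (q' * N * ((q' + 1) * N)) * (∑ t, c t • T t).eval x := by
      simp only [U, eval_finsetSum, eval_smul, smul_eq_mul]
      rw [hP, sum_pow_char_pow, ← hP, Finset.sum_mul, Finset.mul_sum]
      refine Finset.sum_congr rfl fun t _ => ?_
      rw [mul_pow, hP, hb, ← hP]
      obtain ⟨⟨i, hi⟩, ⟨j, hj⟩, ⟨l, hl⟩⟩ := t
      obtain ⟨d, rfl⟩ : ∃ d, q' = i + d := ⟨q' - i, by omega⟩
      simp only [V, T, eval_mul, eval_pow, eval_X, eval_sub, eval_C, Nat.add_sub_cancel,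
        Nat.add_sub_cancel_left]
      set P := (i + d + 1) * N
      have e1 : (x ^ (l + j * P + d * N) * eval x w ^ i) ^ P * x ^ ((i + d) * N) =
          x ^ (l * P) * ((x ^ P) ^ P) ^ j * x ^ (d * N * P) * (eval x w ^ P * x ^ N) ^ i
            * x ^ (d * N) := by ring
      rw [mul_assoc, e1, hxw, hxP, mul_pow _ (τ * x ^ N - eval x w)]
      ring
    rw [hcT, eval_zero, mul_zero] at key
    exact eq_zero_of_pow_eq_zero ((mul_eq_zero.1 key).resolve_right (pow_ne_zero _ hx0))
  have hUd : U.natDegree ≤ N * ((q' + 1) * N) + 5 * ((q' + 1) * N) := by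
    refine natDegree_sum_le_of_forall_le _ _ fun t _ => ?_
    refine (natDegree_smul_le _ _).trans ?_
    rw [hVd]
    obtain ⟨⟨i, hi⟩, ⟨j, hj⟩, ⟨l, hl⟩⟩ := t
    simp only
    have h1 : i * N ≤ (q' + 1) * N := Nat.mul_le_mul_right _ hi.le
    have h2 : j * ((q' + 1) * N) ≤ (N + 2) * ((q' + 1) * N) := Nat.mul_le_mul_right _ (by omega)
    nlinarith
  refine le_trans ?_ hUd
  refine le_trans ?_ (card_roots' U)
  refine le_trans (Finset.card_le_card (t := U.roots.toFinset) fun x hx => ?_)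
    (Multiset.toFinset_card_le _)
  rw [Multiset.mem_toFinset, mem_roots hU0]
  exact hroot x hx

open Polynomial in
theorem card_trace_fiber_le (F : Type) {k : Type} [Field F] [Fintype F] [Field k] [Fintype k]
    [DecidableEq k] [DecidableEq F]
    [Algebra F k] (hF : 3 ≤ Fintype.card F) {e : ℕ} (he : Module.finrank F k = 2 * (e + 1))
    (a : k) (τ : F) :
    #{x : k | x ≠ 0 ∧ Algebra.trace F k (x + a / x) = τ} ≤
      Fintype.card F ^ (2 * e + 1) + 5 * Fintype.card F ^ (e + 1) := by
  obtain ⟨p, hpF⟩ := CharP.exists F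
  obtain ⟨r, hp, hr⟩ := FiniteField.card F p
  have : Fact p.Prime := ⟨hp⟩
  have : CharP k p := charP_of_injective_algebraMap (algebraMap F k).injective p
  set q := Fintype.card F with hq
  have hq0 : 0 < q := by omega
  set N := q ^ e with hN
  have hqN : q * N = q ^ (e + 1) := by rw [hN]; ring
  let w : k[X] := ∑ i ∈ range (e + 1), (X ^ 2 + C a) ^ q ^ i * X ^ (N - q ^ i)
  have hm : ∀ i, ((X ^ 2 + C a : k[X]) ^ q ^ i).Monic := fun i =>
    (monic_X_pow_add_C a two_ne_zero).pow _
  have hle : ∀ {i}, i ≤ e → q ^ i ≤ N := fun hi => Nat.pow_le_pow_right hq0 hi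
  have hd : ∀ i, i ≤ e →
      ((X ^ 2 + C a : k[X]) ^ q ^ i * X ^ (N - q ^ i)).natDegree = N + q ^ i := by
    intro i hi
    rw [(hm i).natDegree_mul (monic_X_pow _), natDegree_X_pow, natDegree_pow,
      natDegree_X_pow_add_C]
    have := hle hi
    omega
  have htop : ((X ^ 2 + C a : k[X]) ^ q ^ e * X ^ (N - q ^ e)).Monic :=
    (hm e).mul (monic_X_pow _)
  have hlow : (∑ i ∈ range e, (X ^ 2 + C a : k[X]) ^ q ^ i * X ^ (N - q ^ i)).degree <
      ((X ^ 2 + C a : k[X]) ^ q ^ e * X ^ (N - q ^ e)).degree := by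
    rw [degree_eq_natDegree htop.ne_zero, hd e le_rfl]
    refine (degree_sum_le _ _).trans_lt ?_
    rw [Finset.sup_lt_iff (WithBot.bot_lt_coe _)]
    intro i hi
    rw [mem_range] at hi
    refine degree_le_natDegree.trans_lt ?_
    rw [hd i hi.le, Nat.cast_lt]
    exact Nat.add_lt_add_left (Nat.pow_lt_pow_right (by omega) hi) _
  have hwm : w.Monic := by
    simp only [w, sum_range_succ]
    rw [add_comm]
    exact htop.add_of_left hlow
  have hwd : w.natDegree = 2 * N := by
    simp only [w, sum_range_succ]
    rw [natDegree_add_eq_right_of_degree_lt hlow, hd e le_rfl]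
    omega
  have hk : Fintype.card k = (q * N) ^ 2 := by
    rw [Module.card_eq_pow_finrank (K := F) (V := k), he, hqN]
    ring
  have hfin := card_le_of_frobenius_relation (k := k) (p := p) (m := r * (e + 1)) (q := q) (N := N)
    hF (Nat.one_le_pow _ _ hq0) (by rw [hqN, hr, pow_mul]) hk w hwm hwd (algebraMap F k τ)
    {x : k | x ≠ 0 ∧ Algebra.trace F k (x + a / x) = τ} ?_
  · refine hfin.trans (le_of_eq ?_)
    rw [hqN, hN]
    ring
  intro x hx
  obtain ⟨hx0, hx⟩ := (mem_filter.1 hx).2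
  refine ⟨hx0, ?_⟩
  set h := x + a / x with hh
  set v := ∑ i ∈ range (e + 1), h ^ q ^ i with hv
  have hwv : w.eval x = x ^ N * v := by
    simp only [w, eval_finsetSum, hv, mul_sum]
    refine sum_congr rfl fun i hi => ?_
    have hi' := hle (Nat.lt_succ_iff.1 (mem_range.1 hi))
    have hx2 : x ^ 2 + a = x * h := by rw [hh]; field_simp
    simp only [eval_mul, eval_pow, eval_add, eval_X, eval_C]
    rw [hx2, mul_pow]
    obtain ⟨c, hc⟩ := Nat.exists_eq_add_of_le hi'
    rw [hc, Nat.add_sub_cancel_left]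
    ring
  have htr : algebraMap F k τ = v + v ^ (q * N) := by
    have h1 := FiniteField.algebraMap_trace_eq_sum_pow F k h
    rw [hx, he, Nat.card_eq_fintype_card, ← hq] at h1
    rw [h1, two_mul, sum_range_add]
    congr 1
    have h2 : q * N = p ^ (r * (e + 1)) := by rw [hqN, hr, pow_mul]
    rw [hv, h2, sum_pow_char_pow, ← h2, hqN]
    refine sum_congr rfl fun i _ => ?_
    rw [← pow_mul]
    ring
  rw [hwv, htr]
  ring

/-- The Kloosterman sum of `χ ∘ Tr` over an extension `k` of `F`. -/
noncomputable def kloostermanSum {F : Type} (k : Type) [Field F] [Field k] [Fintype k]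
    [DecidableEq k] [Algebra F k] (χ : AddChar F ℂ) (a : F) : ℂ :=
  ∑ x : k with x ≠ 0, χ (Algebra.trace F k (x + algebraMap F k a / x))

theorem norm_kloostermanSum_le_of_finrank {F : Type} (k : Type) [Field F] [Fintype F] [Field k]
    [Fintype k] [DecidableEq k] [Algebra F k] (hF : 3 ≤ Fintype.card F) {e : ℕ}
    (he : Module.finrank F k = 2 * (e + 1)) {χ : AddChar F ℂ} (hχ : χ ≠ 1) (a : F) :
    ‖kloostermanSum k χ a‖ ≤ 6 * Fintype.card F * (Fintype.card F : ℝ) ^ (e + 1) := by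
  classical
  set q := Fintype.card F with hq
  let M : F → ℕ := fun τ => #{x : k | x ≠ 0 ∧ Algebra.trace F k (x + algebraMap F k a / x) = τ}
  let B : ℝ := (q : ℝ) ^ (2 * e + 1) + 5 * (q : ℝ) ^ (e + 1)
  have hM : ∀ τ, (M τ : ℝ) ≤ B := fun τ => by
    have h := card_trace_fiber_le F hF he (algebraMap F k a) τ
    simp only [B, M, hq]
    exact_mod_cast h
  have hsum : ∀ f : F → ℂ, ∑ x : k with x ≠ 0, f (Algebra.trace F k (x + algebraMap F k a / x)) =
      ∑ τ, f τ * M τ := by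
    intro f
    rw [← sum_fiberwise (s := ({x : k | x ≠ 0} : Finset k))
      (g := fun x => Algebra.trace F k (x + algebraMap F k a / x))]
    refine sum_congr rfl fun τ _ => ?_
    rw [filter_filter, sum_congr rfl (g := fun _ => f τ), sum_const, nsmul_eq_mul, mul_comm]
    intro x hx
    rw [(mem_filter.1 hx).2.2]
  have htot : ∑ τ, (M τ : ℝ) = (q : ℝ) ^ (2 * (e + 1)) - 1 := by
    have h1 := hsum (fun _ => 1)
    simp only [sum_const, one_mul, nsmul_eq_mul, mul_one, filter_ne', mem_univ,
      card_erase_of_mem, card_univ] at h1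
    have h2 : ((Fintype.card k - 1 : ℕ) : ℝ) = ∑ τ, (M τ : ℝ) := by exact_mod_cast h1
    rw [← h2, Nat.cast_sub Fintype.card_pos, Module.card_eq_pow_finrank (K := F) (V := k), he]
    simp [hq]
  have hK : kloostermanSum k χ a = ∑ τ, χ τ * ((M τ : ℂ) - (B : ℂ)) := by
    rw [kloostermanSum, hsum]
    simp only [mul_sub, sum_sub_distrib, ← sum_mul, AddChar.sum_eq_zero_of_ne_one hχ, zero_mul,
      sub_zero]
  have hq1 : (3 : ℝ) ≤ q := by exact_mod_cast hF
  have h1 : (1 : ℝ) ≤ (q : ℝ) ^ (e + 1) := one_le_pow₀ (by linarith)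
  calc ‖kloostermanSum k χ a‖ ≤ ∑ τ, (B - M τ) := by
        rw [hK]
        refine norm_sum_le_of_le _ fun τ _ => ?_
        rw [norm_mul, AddChar.norm_apply, one_mul, ← Complex.ofReal_natCast, ← Complex.ofReal_sub,
          Complex.norm_real, Real.norm_eq_abs, abs_of_nonpos (by linarith [hM τ])]
        linarith
    _ = q * B - ((q : ℝ) ^ (2 * (e + 1)) - 1) := by
        rw [sum_sub_distrib, htot, sum_const, card_univ, nsmul_eq_mul]
    _ = 5 * q * (q : ℝ) ^ (e + 1) + 1 := by simp only [B]; ring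
    _ ≤ _ := by nlinarith

theorem sum_comp_sq {k : Type} [Field k] [Fintype k] [DecidableEq k] (hk : ringChar k ≠ 2)
    (h : k → ℂ) : ∑ v, h (v ^ 2) = ∑ c, ((quadraticChar k c + 1 : ℤ) : ℂ) * h c := by
  rw [← sum_fiberwise (s := (univ : Finset k)) (g := fun v => v ^ 2)]
  refine sum_congr rfl fun c _ => ?_
  rw [sum_congr rfl (g := fun _ => h c), sum_const, nsmul_eq_mul]
  · have := quadraticChar_card_sqrts hk c
    rw [← this]
    congr 1
    norm_cast
    congr 1
    ext v
    simp
  · intro v hv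
    rw [(mem_filter.1 hv).2]

theorem sum_sq_add_sum_nonsquare_mul_sq {k : Type} [Field k] [Fintype k]
    (hk : ringChar k ≠ 2) {θ : k} (hθ : ¬ IsSquare θ) (g : k → ℂ) :
    ∑ v, g (v ^ 2) + ∑ v, g (θ * v ^ 2) = 2 * ∑ c, g c := by
  classical
  have hθ0 : θ ≠ 0 := by rintro rfl; exact hθ IsSquare.zero
  have hθs : ∑ v, g (θ * v ^ 2) = ∑ c, ((-quadraticChar k c + 1 : ℤ) : ℂ) * g c := by
    rw [sum_comp_sq hk (fun c => g (θ * c)), ← Equiv.sum_comp (Equiv.mulLeft₀ θ hθ0)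
      (fun c => ((-quadraticChar k c + 1 : ℤ) : ℂ) * g c)]
    refine sum_congr rfl fun c _ => ?_
    have : quadraticChar k θ = -1 := quadraticChar_neg_one_iff_not_isSquare.2 hθ
    simp only [Equiv.mulLeft₀_apply, map_mul, this, neg_mul, one_mul, neg_neg]
  rw [sum_comp_sq hk, hθs, ← sum_add_distrib, mul_sum]
  refine sum_congr rfl fun c _ => ?_
  push_cast
  ring

theorem kloostermanSum_quadratic_extension {F k K : Type} [Field F] [Fintype F] [Field k] [Fintype k]
    [DecidableEq k] [Field K] [Fintype K] [DecidableEq K] [Algebra F k] [Algebra k K] [Algebra F K]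
    [IsScalarTower F k K] (hF : ringChar F ≠ 2) (hK : Module.finrank k K = 2)
    {χ : AddChar F ℂ} (hχ : χ ≠ 1) {a : F} (ha : a ≠ 0) :
    kloostermanSum K χ a = 2 * Fintype.card k - kloostermanSum k χ a ^ 2 := by
  have hk : ringChar k ≠ 2 := by rwa [← Algebra.ringChar_eq F k]
  have h2 : (2 : k) ≠ 0 := Ring.two_ne_zero hk
  obtain ⟨θ, hθ⟩ := FiniteField.exists_nonsquare hk
  have hθ0 : θ ≠ 0 := by rintro rfl; exact hθ IsSquare.zero
  set α := algebraMap F k a with hα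
  have hα0 : α ≠ 0 := by rw [hα]; simpa using ha
  let ψ : AddChar k ℂ := χ.compAddMonoidHom (Algebra.trace F k).toAddMonoidHom
  have hψ : ψ ≠ 1 := by
    obtain ⟨x, hx⟩ := AddChar.ne_one_iff.1 hχ
    obtain ⟨y, rfl⟩ := Algebra.trace_surjective F k x
    exact AddChar.ne_one_iff.2 ⟨y, hx⟩
  let G : k → k → ℂ := fun u c => if u ^ 2 - c = 0 then 0 else ψ (2 * u * (1 + α / (u ^ 2 - c)))
  -- the sum over `k`
  have e1 : kloostermanSum k χ a ^ 2 = ∑ u, ∑ v, G u (v ^ 2) := by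
    have hK1 : kloostermanSum k χ a = ∑ x, if x = 0 then 0 else ψ (x + α / x) := by
      rw [kloostermanSum, sum_filter]
      refine sum_congr rfl fun x _ => ?_
      by_cases hx : x = 0 <;> simp [hx, ψ, hα]
    rw [hK1, sq, sum_mul_sum, ← Fintype.sum_prod_type', ← Fintype.sum_prod_type']
    let f : k × k → k × k := fun z => (z.1 + z.2, z.1 - z.2)
    have hf : Function.Bijective f := by
      rw [Fintype.bijective_iff_injective_and_card]
      refine ⟨?_, rfl⟩
      rintro ⟨u, v⟩ ⟨u', v'⟩ h
      simp only [f, Prod.mk.injEq] at h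
      obtain ⟨h3, h4⟩ := h
      have h5 : u = u' := mul_left_cancel₀ h2 (by linear_combination h3 + h4)
      have h6 : v = v' := mul_left_cancel₀ h2 (by linear_combination h3 - h4)
      rw [h5, h6]
    symm
    refine Fintype.sum_bijective f hf _ _ fun ⟨u, v⟩ => ?_
    simp only [f, G]
    have h7 : u ^ 2 - v ^ 2 = (u + v) * (u - v) := by ring
    by_cases h8 : u + v = 0
    · simp [h7, h8]
    by_cases h9 : u - v = 0
    · simp [h7, h9]
    rw [if_neg (by rw [h7]; exact mul_ne_zero h8 h9), if_neg h8, if_neg h9,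
      ← AddChar.map_add_eq_mul, h7]
    congr 1
    field_simp
    ring
  -- the sum over `K`
  have e2 : kloostermanSum K χ a = ∑ u, ∑ v, G u (θ * v ^ 2) := by
    have hcK : Fintype.card K = Fintype.card k ^ 2 := by
      rw [Module.card_eq_pow_finrank (K := k) (V := K), hK]
    have hK2 : ringChar K ≠ 2 := by rwa [← Algebra.ringChar_eq k K]
    have hodd : Fintype.card k % 2 = 1 := FiniteField.odd_card_of_char_ne_two hk
    have hθpow : θ ^ (Fintype.card k / 2) = -1 :=
      (FiniteField.pow_dichotomy hk hθ0).resolve_left fun h =>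
        hθ ((FiniteField.isSquare_iff hk hθ0).2 h)
    have hinj := (algebraMap k K).injective
    obtain ⟨ω, hω⟩ : IsSquare (algebraMap k K θ) := by
      rw [FiniteField.isSquare_iff hK2 (by simpa using hθ0), ← map_pow, hcK]
      obtain ⟨s, hs⟩ : ∃ s, Fintype.card k = 2 * s + 1 := ⟨Fintype.card k / 2, by omega⟩
      have h3 : Fintype.card k ^ 2 / 2 = Fintype.card k / 2 * (2 * (s + 1)) := by
        rw [hs, show (2 * s + 1) ^ 2 = 1 + 2 * (s * (2 * (s + 1))) by ring,
          Nat.add_mul_div_left _ _ two_pos, show (2 * s + 1) / 2 = s by omega]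
        omega
      rw [h3, pow_mul, hθpow, pow_mul]
      simp
    have hωpow : ω ^ Fintype.card k = -ω := by
      obtain ⟨s, hs⟩ : ∃ s, Fintype.card k = 2 * s + 1 := ⟨Fintype.card k / 2, by omega⟩
      have h3 : Fintype.card k / 2 = s := by omega
      rw [hs, pow_succ, pow_mul, sq, ← hω, ← map_pow, ← h3, hθpow]
      simp
    have hωk : ∀ c, algebraMap k K c ≠ ω := by
      intro c hc
      apply hθ
      refine ⟨c, hinj ?_⟩
      rw [hω, map_mul, hc]
    let f : k × k → K := fun z => algebraMap k K z.1 + algebraMap k K z.2 * ω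
    have hf0 : ∀ u v, algebraMap k K u + algebraMap k K v * ω = 0 → u = 0 ∧ v = 0 := by
      intro u v h
      have hv : v = 0 := by
        by_contra hv
        apply hωk (-u / v)
        have hv' : algebraMap k K v ≠ 0 := by simpa using hv
        rw [map_div₀, map_neg, div_eq_iff hv']
        linear_combination -h
      subst hv
      simpa using h
    have hf : Function.Bijective f := by
      rw [Fintype.bijective_iff_injective_and_card]
      refine ⟨?_, by rw [Fintype.card_prod, hcK, sq]⟩
      rintro ⟨u, v⟩ ⟨u', v'⟩ h
      simp only [f] at h
      have := hf0 (u - u') (v - v') (by rw [map_sub, map_sub]; linear_combination h)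
      rw [sub_eq_zero.1 this.1, sub_eq_zero.1 this.2]
    rw [kloostermanSum, sum_filter, ← Fintype.sum_prod_type']
    symm
    refine Fintype.sum_bijective f hf _ _ fun ⟨u, v⟩ => ?_
    simp only [f, G]
    set z : K := algebraMap k K u + algebraMap k K v * ω with hz
    set zc : K := algebraMap k K u - algebraMap k K v * ω with hzc
    have hnorm : algebraMap k K (u ^ 2 - θ * v ^ 2) = z * zc := by
      rw [map_sub, map_mul, map_pow, map_pow, hω, hz, hzc]
      ring
    have hz0 : u ^ 2 - θ * v ^ 2 = 0 ↔ z = 0 := by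
      rw [← map_eq_zero (algebraMap k K), hnorm, mul_eq_zero, or_iff_left_of_imp]
      intro h
      have := hf0 u (-v) (by rw [map_neg]; linear_combination h)
      rw [hz, this.1, neg_eq_zero.1 this.2]
      simp
    by_cases hzz : z = 0
    · rw [if_pos (hz0.2 hzz), if_neg (not_not.2 hzz)]
    rw [if_neg (mt hz0.1 hzz), if_pos hzz]
    have hzc0 : zc ≠ 0 := by
      intro h
      apply hzz
      rw [← hz0, ← map_eq_zero (algebraMap k K), hnorm, h, mul_zero]
    have hfrob : ∀ x y : k, (algebraMap k K x + algebraMap k K y * ω) ^ Fintype.card k =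
        algebraMap k K x - algebraMap k K y * ω := by
      intro x y
      obtain ⟨p, hpk⟩ := CharP.exists k
      obtain ⟨r, hp, hr⟩ := FiniteField.card k p
      have : Fact p.Prime := ⟨hp⟩
      have : CharP K p := charP_of_injective_algebraMap (algebraMap k K).injective p
      rw [hr, add_pow_char_pow, mul_pow, ← hr, hωpow, ← map_pow, ← map_pow, FiniteField.pow_card,
        FiniteField.pow_card]
      ring
    have htr : Algebra.trace k K (z + algebraMap F K a / z) =
        2 * u * (1 + α / (u ^ 2 - θ * v ^ 2)) := by
      have hn0 : u ^ 2 - θ * v ^ 2 ≠ 0 := mt hz0.1 hzz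
      apply hinj
      rw [FiniteField.algebraMap_trace_eq_sum_pow, hK, Nat.card_eq_fintype_card]
      simp only [sum_range_succ, sum_range_zero, pow_zero, pow_one, zero_add]
      have h3 : z + algebraMap F K a / z =
          algebraMap k K (u + α * u / (u ^ 2 - θ * v ^ 2)) +
          algebraMap k K (v - α * v / (u ^ 2 - θ * v ^ 2)) * ω := by
        simp only [map_add, map_sub, map_div₀, map_mul, hα, ← IsScalarTower.algebraMap_apply]
        rw [← map_mul, ← map_sub, hnorm]
        field_simp
        rw [hz, hzc]
        ring
      rw [h3, hfrob]
      simp only [map_add, map_mul, map_div₀, map_sub, map_ofNat, map_one]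
      ring
    rw [← Algebra.trace_trace (R := F) (S := k), htr]
    rfl
  have e3 : ∑ u, ∑ c, G u c = Fintype.card k := by
    have h3 : ∀ u, ∑ c, G u c = ∑ n, if n = 0 then 0 else ψ (u * (2 * (1 + α / n))) := by
      intro u
      rw [← Equiv.sum_comp (Equiv.subLeft (u ^ 2))]
      refine sum_congr rfl fun n _ => ?_
      simp only [G, Equiv.subLeft_apply, sub_sub_cancel]
      congr 2
      ring
    simp only [h3]
    rw [sum_comm, sum_eq_single (-α)]
    · simp [hα0]
    · intro n _ hn
      by_cases hn0 : n = 0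
      · simp [hn0]
      simp only [hn0, if_false]
      rw [AddChar.sum_mulShift _ (AddChar.IsPrimitive.of_ne_one hψ), if_neg, Nat.cast_zero]
      refine mul_ne_zero h2 fun h => hn ?_
      field_simp at h
      linear_combination h
    · simp
  have e4 : kloostermanSum k χ a ^ 2 + kloostermanSum K χ a = 2 * Fintype.card k := by
    rw [e1, e2, ← e3, mul_sum, ← sum_add_distrib]
    exact sum_congr rfl fun u _ => sum_sq_add_sum_nonsquare_mul_sq hk hθ (G u)
  linear_combination e4

theorem exists_extension_kloostermanSum {F : Type} [Field F] [Fintype F] [DecidableEq F]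
    (hF : ringChar F ≠ 2) {χ : AddChar F ℂ} (hχ : χ ≠ 1) {a : F} (ha : a ≠ 0) {κ : ℕ → ℂ}
    (hκ0 : κ 0 = kloostermanSum F χ a)
    (hκ : ∀ j, κ (j + 1) = 2 * (Fintype.card F : ℂ) ^ 2 ^ j - κ j ^ 2) (j : ℕ) :
    ∃ (k : Type) (_ : Field k) (_ : Fintype k) (_ : DecidableEq k) (_ : Algebra F k),
      Module.finrank F k = 2 ^ j ∧ kloostermanSum k χ a = κ j := by
  classical
  induction j with
  | zero => exact ⟨F, _, inferInstance, inferInstance, Algebra.id F, by simp, hκ0.symm⟩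
  | succ j ih =>
    obtain ⟨k, _, _, _, _, hfr, hk⟩ := ih
    obtain ⟨p, hpk⟩ := CharP.exists k
    have : Fact p.Prime := ⟨CharP.char_is_prime k p⟩
    let K := FiniteField.Extension k p 2
    have hK : Module.finrank k K = 2 := FiniteField.finrank_extension k p 2
    let : Fintype K := Fintype.ofFinite K
    let : Algebra F K := ((algebraMap k K).comp (algebraMap F k)).toAlgebra
    have : IsScalarTower F k K := IsScalarTower.of_algebraMap_eq fun _ => rfl
    refine ⟨K, inferInstance, inferInstance, inferInstance, inferInstance, ?_, ?_⟩
    · rw [← Module.finrank_mul_finrank F k K, hfr, hK, pow_succ]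
    · rw [kloostermanSum_quadratic_extension (k := k) hF hK hχ ha, hk, hκ,
        Module.card_eq_pow_finrank (K := F) (V := k), hfr]
      push_cast
      rfl

theorem norm_kloostermanSum_le {F : Type} [Field F] [Fintype F] [DecidableEq F]
    (hF : ringChar F ≠ 2) {χ : AddChar F ℂ} (hχ : χ ≠ 1) {a : F} (ha : a ≠ 0) :
    ‖kloostermanSum F χ a‖ ≤ 2 * √(Fintype.card F) := by
  set q := Fintype.card F with hq
  have hq3 : 3 ≤ q := by
    have := FiniteField.odd_card_of_char_ne_two hF
    have h1 : 1 < Fintype.card F := Fintype.one_lt_card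
    omega
  have hq0 : (0 : ℝ) < q := by exact_mod_cast (by omega : 0 < q)
  let κ : ℕ → ℂ := fun j => Nat.rec (kloostermanSum F χ a)
    (fun j z => 2 * (q : ℂ) ^ 2 ^ j - z ^ 2) j
  have hκ : ∀ j, κ (j + 1) = 2 * (q : ℂ) ^ 2 ^ j - κ j ^ 2 := fun j => rfl
  set s := √(q : ℝ) with hs
  have hs0 : 0 < s := Real.sqrt_pos.2 hq0
  have hss : s ^ 2 = q := Real.sq_sqrt hq0.le
  have hbound : ∀ j, ‖κ (j + 1)‖ ≤ 6 * q * s ^ 2 ^ (j + 1) := by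
    intro j
    obtain ⟨k, _, _, _, _, hfr, hk⟩ :=
      exists_extension_kloostermanSum hF hχ ha (κ := κ) rfl hκ (j + 1)
    obtain ⟨e, he⟩ : ∃ e, 2 ^ j = e + 1 := ⟨2 ^ j - 1, (Nat.sub_add_cancel Nat.one_le_two_pow).symm⟩
    have hfr' : Module.finrank F k = 2 * (e + 1) := by rw [hfr, pow_succ, he, mul_comm]
    rw [← hk]
    refine (norm_kloostermanSum_le_of_finrank k hq3 hfr' hχ a).trans (le_of_eq ?_)
    rw [← hq, ← he, pow_succ 2 j, mul_comm (2 ^ j) 2, pow_mul, hss]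
  by_contra! hcon
  obtain ⟨η, hη, hη'⟩ : ∃ η, 0 < η ∧ ‖kloostermanSum F χ a‖ = (2 + η) * s := by
    refine ⟨‖kloostermanSum F χ a‖ / s - 2, ?_, ?_⟩
    · rw [sub_pos, lt_div_iff₀ hs0]; exact hcon
    · field_simp; ring
  have hgrow : ∀ j, (2 + 4 ^ j * η) * s ^ 2 ^ j ≤ ‖κ j‖ := by
    intro j
    induction j with
    | zero => simpa [κ] using hη'.ge
    | succ j ih =>
      have hp : 0 < s ^ 2 ^ j := by positivity
      have h4 : 0 < (4 : ℝ) ^ j * η := by positivity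
      have h1 : ‖κ j‖ ^ 2 - 2 * (q : ℝ) ^ 2 ^ j ≤ ‖κ (j + 1)‖ := by
        rw [hκ]
        have := norm_sub_norm_le (κ j ^ 2) (2 * (q : ℂ) ^ 2 ^ j)
        rw [norm_sub_rev] at this
        simpa using this
      have h2 : (q : ℝ) ^ 2 ^ j = (s ^ 2 ^ j) ^ 2 := by rw [← hss]; ring
      have h3 : s ^ 2 ^ (j + 1) = (s ^ 2 ^ j) ^ 2 := by rw [pow_succ 2 j, pow_mul]
      have h5 : ((2 + 4 ^ j * η) * s ^ 2 ^ j) ^ 2 ≤ ‖κ j‖ ^ 2 := by gcongr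
      rw [h3]
      rw [h2] at h1
      rw [pow_succ 4 j]
      nlinarith [mul_pos (mul_pos h4 h4) (pow_pos hp 2)]
  obtain ⟨j, hj⟩ := pow_unbounded_of_one_lt (6 * q / η) (by norm_num : (1 : ℝ) < 4)
  have h1 := (hgrow (j + 1)).trans (hbound j)
  have h2 := le_of_mul_le_mul_right h1 (by positivity)
  rw [div_lt_iff₀ hη] at hj
  rw [pow_succ] at h2
  nlinarith

/-- The quadratic character of a finite field with complex values. -/
noncomputable def complexQuadraticChar (F : Type) [Field F] [Fintype F] [DecidableEq F] :
    MulChar F ℂ :=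
  (quadraticChar F).ringHomComp (Int.castRingHom ℂ)

theorem addChar_map_sum {G ι : Type} [AddCommGroup G] (χ : AddChar G ℂ) (s : Finset ι)
    (f : ι → G) : χ (∑ i ∈ s, f i) = ∏ i ∈ s, χ (f i) :=
  map_prod χ.toMonoidHom (fun i => Multiplicative.ofAdd (f i)) s

theorem one_le_sqrt_card {F : Type} [Fintype F] [Nonempty F] : 1 ≤ √(Fintype.card F : ℝ) :=
  Real.one_le_sqrt.mpr (by exact_mod_cast Fintype.card_pos)

theorem addChar_pi_eq {F : Type} [Field F] [Fintype F] {χ : AddChar F ℂ} (hχ : χ ≠ 1) {ι : Type}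
    [Fintype ι] [DecidableEq ι] (φ : AddChar (ι → F) ℂ) : ∃ c : ι → F, ∀ x, φ x = χ (∑ i, c i * x i) := by
  have hsurj : Function.Surjective (χ.mulShift ·) :=
    ((Fintype.bijective_iff_injective_and_card _).mpr
      ⟨AddChar.to_mulShift_inj_of_isPrimitive (AddChar.IsPrimitive.of_ne_one hχ),
        AddChar.card_eq.symm⟩).2
  choose c hc using fun i => hsurj (φ.compAddMonoidHom (AddMonoidHom.single (fun _ => F) i))
  refine ⟨c, fun x => ?_⟩
  rw [addChar_map_sum]
  conv_lhs => rw [← Finset.univ_sum_single x, addChar_map_sum]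
  refine Finset.prod_congr rfl fun i _ => ?_
  exact (DFunLike.congr_fun (hc i) (x i)).symm

section QuadraticExponentialSums

variable {F : Type} [Field F] [Fintype F] [DecidableEq F]

theorem complexQuadraticChar_apply (u : F) :
    complexQuadraticChar F u = ((quadraticChar F u : ℤ) : ℂ) := rfl

theorem complexQuadraticChar_mul_self {u : F} (hu : u ≠ 0) :
    complexQuadraticChar F u * complexQuadraticChar F u = 1 := by
  rw [complexQuadraticChar_apply, ← Int.cast_mul, ← sq, quadraticChar_sq_one hu, Int.cast_one]

theorem norm_complexQuadraticChar {u : F} (hu : u ≠ 0) : ‖complexQuadraticChar F u‖ = 1 := by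
  have h := congrArg norm (complexQuadraticChar_mul_self hu)
  rw [norm_mul, norm_one] at h
  nlinarith [norm_nonneg (complexQuadraticChar F u)]

theorem norm_gaussSum_complexQuadraticChar (hF : ringChar F ≠ 2) {χ : AddChar F ℂ} (hχ : χ ≠ 1) :
    ‖gaussSum (complexQuadraticChar F) χ‖ = √(Fintype.card F) := by
  have hne : complexQuadraticChar F ≠ 1 :=
    (MulChar.ringHomComp_ne_one_iff (RingHom.injective_int _)).mpr (quadraticChar_ne_one hF)
  have h := congrArg norm (gaussSum_sq hne ((quadraticChar_isQuadratic F).comp _)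
    (AddChar.IsPrimitive.of_ne_one hχ))
  rw [norm_pow, norm_mul, norm_complexQuadraticChar (neg_ne_zero.mpr one_ne_zero), one_mul,
    Complex.norm_natCast] at h
  rw [← h, Real.sqrt_sq (norm_nonneg _)]

theorem sum_quadratic_exponential (hF : ringChar F ≠ 2) {χ : AddChar F ℂ} (hχ : χ ≠ 1) {u : F}
    (hu : u ≠ 0) (c : F) :
    ∑ y, χ (u * y ^ 2 + c * y) =
      complexQuadraticChar F u * gaussSum (complexQuadraticChar F) χ * χ (-(c ^ 2 / (4 * u))) := by
  have h2 : (2 : F) ≠ 0 := Ring.two_ne_zero hF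
  have hshift : ∑ y, χ (u * y ^ 2 + c * y) = ∑ y, χ (u * y ^ 2) * χ (-(c ^ 2 / (4 * u))) := by
    rw [← Equiv.sum_comp (Equiv.subRight (c / (2 * u)))]
    refine Finset.sum_congr rfl fun y _ => ?_
    rw [← AddChar.map_add_eq_mul]
    congr 1
    have h4 : (4 : F) = 2 * 2 := by norm_num
    rw [Equiv.subRight_apply, h4]
    field_simp
    ring
  rw [hshift, ← Finset.sum_mul, sum_comp_sq hF (fun y => χ (u * y))]
  congr 1
  have hG := gaussSum_mulShift (complexQuadraticChar F) χ (Units.mk0 u hu)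
  rw [Units.val_mk0] at hG
  have hzero : ∑ y, χ (u * y) = 0 :=
    AddChar.sum_eq_zero_of_ne_one (ψ := χ.mulShift u) (AddChar.IsPrimitive.of_ne_one hχ hu)
  rw [← hG, ← mul_assoc, complexQuadraticChar_mul_self hu, one_mul]
  simp only [Int.cast_add, Int.cast_one, add_mul, one_mul, Finset.sum_add_distrib, hzero, add_zero]
  rfl

theorem sum_diagonal_quadratic_exponential (hF : ringChar F ≠ 2) {χ : AddChar F ℂ} (hχ : χ ≠ 1)
    {ι : Type} [Fintype ι] [DecidableEq ι] {w : ι → F} (hw : ∀ i, w i ≠ 0) {u : F} (hu : u ≠ 0)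
    (c : ι → F) :
    ∑ x : ι → F, χ (u * ∑ i, w i * x i ^ 2 + ∑ i, c i * x i) =
      (∏ i, complexQuadraticChar F (w i) * gaussSum (complexQuadraticChar F) χ) *
        (complexQuadraticChar F u ^ Fintype.card ι * χ (-((∑ i, c i ^ 2 / (4 * w i)) / u))) := by
  have hfactor : ∀ x : ι → F, χ (u * ∑ i, w i * x i ^ 2 + ∑ i, c i * x i) =
      ∏ i, χ (u * w i * x i ^ 2 + c i * x i) := by
    intro x
    rw [Finset.mul_sum, ← Finset.sum_add_distrib, addChar_map_sum]
    simp only [mul_assoc]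
  simp_rw [hfactor]
  rw [← Fintype.prod_sum (fun i y => χ (u * w i * y ^ 2 + c i * y)), Finset.sum_div,
    ← Finset.sum_neg_distrib, addChar_map_sum, ← Finset.card_univ, ← Finset.prod_const,
    ← Finset.prod_mul_distrib, ← Finset.prod_mul_distrib]
  refine Finset.prod_congr rfl fun i _ => ?_
  rw [sum_quadratic_exponential hF hχ (mul_ne_zero hu (hw i)), map_mul]
  have : c i ^ 2 / (4 * (u * w i)) = c i ^ 2 / (4 * w i) / u := by
    rw [div_div, mul_assoc, mul_comm u]
  rw [this]
  ring

theorem sum_ne_zero_addChar {χ : AddChar F ℂ} (hχ : χ ≠ 1) :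
    ∑ u : F with u ≠ 0, χ u = -1 := by
  have h := AddChar.sum_eq_zero_of_ne_one hχ
  rw [← Finset.sum_erase_add _ _ (Finset.mem_univ (0 : F)), AddChar.map_zero_eq_one] at h
  rw [Finset.filter_ne']
  exact eq_neg_of_add_eq_zero_left h

theorem sum_ne_zero_comp_mul (f : F → ℂ) {a : F} (ha : a ≠ 0) :
    ∑ u : F with u ≠ 0, f (a * u) = ∑ u : F with u ≠ 0, f u := by
  refine Finset.sum_equiv (Equiv.mulLeft₀ a ha) ?_ ?_
  · simp [ha]
  · simp

/-- Kloosterman sums, including the degenerate ones, have square-root cancellation. -/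
theorem norm_sum_addChar_add_div_le (hF : ringChar F ≠ 2) {χ : AddChar F ℂ} (hχ : χ ≠ 1) {t : F}
    (ht : t ≠ 0) (β : F) :
    ‖∑ u : F with u ≠ 0, χ (-(u * t)) * χ (-(β / u))‖ ≤ 2 * √(Fintype.card F) := by
  rw [← sum_ne_zero_comp_mul _ (neg_ne_zero.mpr (inv_ne_zero ht))]
  by_cases hβ : β = 0
  · have : ∑ u : F with u ≠ 0, χ (-(-t⁻¹ * u * t)) * χ (-(β / (-t⁻¹ * u))) = -1 := by
      rw [← sum_ne_zero_addChar hχ]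
      refine Finset.sum_congr rfl fun u _ => ?_
      rw [hβ, zero_div, neg_zero, AddChar.map_zero_eq_one, mul_one]
      congr 1
      field_simp
    rw [this, norm_neg, norm_one]
    linarith [one_le_sqrt_card (F := F)]
  · refine le_of_eq_of_le (congrArg norm ?_) (norm_kloostermanSum_le hF hχ (mul_ne_zero hβ ht))
    refine Finset.sum_congr rfl fun u hu => ?_
    have hu : u ≠ 0 := (Finset.mem_filter.mp hu).2
    rw [← AddChar.map_add_eq_mul, Algebra.trace_self_apply, Algebra.algebraMap_self,
      RingHom.id_apply]
    congr 1
    field_simp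

/-- Salié sums, including the degenerate ones, have square-root cancellation. -/
theorem norm_sum_quadraticChar_addChar_add_div_le (hF : ringChar F ≠ 2) {χ : AddChar F ℂ}
    (hχ : χ ≠ 1) {t : F} (ht : t ≠ 0) (β : F) :
    ‖∑ u : F with u ≠ 0, complexQuadraticChar F u * (χ (-(u * t)) * χ (-(β / u)))‖ ≤
      2 * √(Fintype.card F) := by
  have hG := norm_gaussSum_complexQuadraticChar hF hχ
  have hq := one_le_sqrt_card (F := F)
  by_cases hβ : β = 0
  · have hS : ∑ u : F with u ≠ 0, complexQuadraticChar F u * (χ (-(u * t)) * χ (-(β / u))) =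
        gaussSum (complexQuadraticChar F) (χ.mulShift (-t)) := by
      rw [gaussSum, Finset.sum_filter]
      refine Finset.sum_congr rfl fun u _ => ?_
      split_ifs with hu
      · rw [hβ, zero_div, neg_zero, AddChar.map_zero_eq_one, mul_one, AddChar.mulShift_apply]
        ring_nf
      · rw [not_not.mp hu, MulChar.map_zero, zero_mul]
    rw [hS, norm_gaussSum_complexQuadraticChar hF
      (AddChar.IsPrimitive.of_ne_one hχ (neg_ne_zero.mpr ht))]
    linarith
  · rw [← sum_ne_zero_comp_mul _ hβ]
    set S := ∑ u : F with u ≠ 0,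
      complexQuadraticChar F (β * u) * (χ (-(β * u * t)) * χ (-(β / (β * u)))) with hS
    have key : gaussSum (complexQuadraticChar F) χ * S = complexQuadraticChar F β *
        ∑ y : F, χ (2 * y) * if y ^ 2 - β * t = 0 then (Fintype.card F : ℂ) else 0 := by
      have h1 : ∀ u : F, u ≠ 0 → gaussSum (complexQuadraticChar F) χ *
          (complexQuadraticChar F (β * u) * (χ (-(β * u * t)) * χ (-(β / (β * u))))) =
          complexQuadraticChar F β * ∑ y, χ (2 * y) * χ (u * (y ^ 2 - β * t)) := by
        intro u hu
        have h := sum_quadratic_exponential hF hχ hu 2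
        have h2 : (2 : F) ≠ 0 := Ring.two_ne_zero hF
        have e : (2 : F) ^ 2 / (4 * u) = β / (β * u) := by
          have h4 : (4 : F) = 2 * 2 := by norm_num
          rw [h4]
          field_simp
        rw [e] at h
        have h' : ∑ y, χ (2 * y) * χ (u * (y ^ 2 - β * t)) =
            (∑ y, χ (u * y ^ 2 + 2 * y)) * χ (-(β * u * t)) := by
          rw [Finset.sum_mul]
          refine Finset.sum_congr rfl fun y _ => ?_
          rw [← AddChar.map_add_eq_mul, ← AddChar.map_add_eq_mul]
          ring_nf
        rw [h', h, map_mul]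
        ring
      have h2 : ∑ y : F, χ (2 * y) = 0 := AddChar.sum_eq_zero_of_ne_one (ψ := χ.mulShift 2)
        (AddChar.IsPrimitive.of_ne_one hχ (Ring.two_ne_zero hF))
      rw [hS, Finset.mul_sum, Finset.sum_congr rfl fun u hu => h1 u (Finset.mem_filter.mp hu).2,
        ← Finset.mul_sum]
      congr 1
      have h3 : ∑ u : F with u ≠ 0, ∑ y, χ (2 * y) * χ (u * (y ^ 2 - β * t)) =
          ∑ u : F, ∑ y, χ (2 * y) * χ (u * (y ^ 2 - β * t)) := by
        refine Finset.sum_filter_of_ne fun u _ hne h0 => hne ?_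
        simpa [h0] using h2
      rw [h3, Finset.sum_comm]
      refine Finset.sum_congr rfl fun y _ => ?_
      rw [← Finset.mul_sum, AddChar.sum_mulShift _ (AddChar.IsPrimitive.of_ne_one hχ),
        Nat.cast_ite, Nat.cast_zero]
    have hroots : #{y : F | y ^ 2 - β * t = 0} ≤ 2 := by
      have : ({y : F | y ^ 2 - β * t = 0} : Finset F) ⊆
          (Polynomial.nthRoots 2 (β * t)).toFinset := by
        intro y hy
        rw [Multiset.mem_toFinset, Polynomial.mem_nthRoots two_pos]
        exact sub_eq_zero.mp (Finset.mem_filter.mp hy).2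
      exact (Finset.card_le_card this).trans
        ((Multiset.toFinset_card_le _).trans (Polynomial.card_nthRoots 2 _))
    have hbound : √(Fintype.card F) * ‖S‖ ≤ 2 * Fintype.card F := by
      rw [← hG, ← norm_mul, key, norm_mul, norm_complexQuadraticChar hβ, one_mul]
      refine (norm_sum_le _ _).trans ?_
      have : ∀ y : F, ‖χ (2 * y) * if y ^ 2 - β * t = 0 then (Fintype.card F : ℂ) else 0‖ =
          if y ^ 2 - β * t = 0 then (Fintype.card F : ℝ) else 0 := by
        intro y
        rw [norm_mul, AddChar.norm_apply, one_mul]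
        split_ifs <;> simp
      simp_rw [this]
      rw [← Finset.sum_filter, Finset.sum_const, nsmul_eq_mul]
      gcongr
      exact_mod_cast hroots
    have hsq := Real.mul_self_sqrt (Nat.cast_nonneg (α := ℝ) (Fintype.card F))
    nlinarith [norm_nonneg S]

theorem norm_sum_quadraticChar_pow_addChar_add_div_le (hF : ringChar F ≠ 2) {χ : AddChar F ℂ}
    (hχ : χ ≠ 1) {t : F} (ht : t ≠ 0) (β : F) (n : ℕ) :
    ‖∑ u : F with u ≠ 0, complexQuadraticChar F u ^ n * (χ (-(u * t)) * χ (-(β / u)))‖ ≤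
      2 * √(Fintype.card F) := by
  have hsq : ∀ u : F, u ≠ 0 → ∀ m, complexQuadraticChar F u ^ (m + m) = 1 := by
    intro u hu m
    rw [pow_add, ← mul_pow, complexQuadraticChar_mul_self hu, one_pow]
  rcases Nat.even_or_odd' n with ⟨m, rfl | rfl⟩
  · refine le_of_eq_of_le (congrArg norm ?_) (norm_sum_addChar_add_div_le hF hχ ht β)
    refine Finset.sum_congr rfl fun u hu => ?_
    rw [two_mul, hsq u (Finset.mem_filter.mp hu).2, one_mul]
  · refine le_of_eq_of_le (congrArg norm ?_)
      (norm_sum_quadraticChar_addChar_add_div_le hF hχ ht β)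
    refine Finset.sum_congr rfl fun u hu => ?_
    rw [pow_succ, two_mul, hsq u (Finset.mem_filter.mp hu).2, one_mul]

theorem norm_sum_diagonal_level_sub_le (hF : ringChar F ≠ 2) {ι : Type} [Fintype ι]
    [DecidableEq ι] {w : ι → F} (hw : ∀ i, w i ≠ 0) {t : F} (ht : t ≠ 0)
    (φ : AddChar (ι → F) ℂ) :
    ‖(Fintype.card F : ℂ) * (∑ x : ι → F with ∑ i, w i * x i ^ 2 = t, φ x) - ∑ x, φ x‖ ≤
      √(Fintype.card F) ^ Fintype.card ι * (2 * √(Fintype.card F)) := by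
  obtain ⟨χ, hχ⟩ : ∃ χ : AddChar F ℂ, χ ≠ 1 := by
    have : Nontrivial (AddChar F ℂ) := by
      rw [← Fintype.one_lt_card_iff_nontrivial, AddChar.card_eq]
      exact Fintype.one_lt_card
    exact exists_ne 1
  obtain ⟨c, hc⟩ := addChar_pi_eq hχ φ
  have hlevel : (Fintype.card F : ℂ) * (∑ x : ι → F with ∑ i, w i * x i ^ 2 = t, φ x) =
      ∑ u : F, ∑ x : ι → F, χ (-(u * t)) * χ (u * ∑ i, w i * x i ^ 2 + ∑ i, c i * x i) := by
    rw [Finset.sum_comm, Finset.mul_sum, Finset.sum_filter]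
    refine Finset.sum_congr rfl fun x _ => ?_
    have h := AddChar.sum_mulShift (∑ i, w i * x i ^ 2 - t) (AddChar.IsPrimitive.of_ne_one hχ)
    have h' : ∑ u : F, χ (-(u * t)) * χ (u * ∑ i, w i * x i ^ 2 + ∑ i, c i * x i) =
        (∑ u : F, χ (u * (∑ i, w i * x i ^ 2 - t))) * φ x := by
      rw [Finset.sum_mul]
      refine Finset.sum_congr rfl fun u _ => ?_
      rw [hc, ← AddChar.map_add_eq_mul, ← AddChar.map_add_eq_mul]
      ring_nf
    rw [h', h]
    simp only [sub_eq_zero, Nat.cast_ite, Nat.cast_zero, ite_mul, zero_mul]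
  have hsplit : (Fintype.card F : ℂ) * (∑ x : ι → F with ∑ i, w i * x i ^ 2 = t, φ x) -
      ∑ x, φ x = (∏ i, complexQuadraticChar F (w i) * gaussSum (complexQuadraticChar F) χ) *
        ∑ u : F with u ≠ 0, complexQuadraticChar F u ^ Fintype.card ι *
          (χ (-(u * t)) * χ (-((∑ i, c i ^ 2 / (4 * w i)) / u))) := by
    rw [hlevel, ← Finset.sum_erase_add _ _ (Finset.mem_univ (0 : F)), ← Finset.filter_ne',
      Finset.mul_sum]
    simp only [zero_mul, neg_zero, AddChar.map_zero_eq_one, zero_add, one_mul, hc,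
      add_sub_cancel_right]
    refine Finset.sum_congr rfl fun u hu => ?_
    rw [← Finset.mul_sum, sum_diagonal_quadratic_exponential hF hχ hw (Finset.mem_filter.mp hu).2]
    ring
  rw [hsplit, norm_mul, norm_prod]
  simp only [norm_mul, norm_complexQuadraticChar (hw _),
    norm_gaussSum_complexQuadraticChar hF hχ, one_mul, Finset.prod_const, Finset.card_univ]
  gcongr
  exact norm_sum_quadraticChar_pow_addChar_add_div_le hF hχ ht _ _

end QuadraticExponentialSums

theorem norm_sum_level_sub_le {F : Type} [Field F] [Fintype F] [DecidableEq F]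
    (hF : ringChar F ≠ 2) {d : ℕ} (Q : QuadraticForm F (Fin d → F))
    (hQ : LinearMap.Nondegenerate (QuadraticMap.polarBilin Q)) {t : F} (ht : t ≠ 0)
    (φ : AddChar (Fin d → F) ℂ) :
    ‖(Fintype.card F : ℂ) * (∑ x : Fin d → F with Q x = t, φ x) - ∑ x, φ x‖ ≤
      √(Fintype.card F) ^ d * (2 * √(Fintype.card F)) := by
  have h2 : (2 : F) ≠ 0 := Ring.two_ne_zero hF
  have : Invertible (2 : F) := invertibleOfNonzero h2
  have hsep : (QuadraticMap.associated (R := F) Q).SeparatingLeft := by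
    intro x hx
    refine hQ.1 x fun y => ?_
    rw [← QuadraticMap.two_nsmul_associated F, LinearMap.smul_apply, LinearMap.smul_apply, hx y,
      smul_zero]
  obtain ⟨w, ⟨e⟩⟩ := QuadraticForm.equivalent_weightedSumSquares_units_of_nondegenerate' Q hsep
  have hval : ∀ x, ∑ i, (w i : F) * e x i ^ 2 = Q x := by
    intro x
    rw [← e.map_app x, QuadraticMap.weightedSumSquares_apply]
    refine Finset.sum_congr rfl fun i _ => ?_
    rw [Units.smul_def, smul_eq_mul, sq]
  have h := norm_sum_diagonal_level_sub_le hF (w := fun i => (w i : F)) (fun i => (w i).ne_zero) ht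
    (φ.compAddMonoidHom e.symm.toLinearEquiv.toAddMonoidHom)
  have hsymm : ∀ x, e.symm.toLinearEquiv.toAddMonoidHom (e x) = x := fun x =>
    e.toLinearEquiv.symm_apply_apply x
  rw [← Equiv.sum_comp e.toLinearEquiv.toEquiv, Finset.sum_filter,
    ← Equiv.sum_comp e.toLinearEquiv.toEquiv] at h
  rw [Finset.sum_filter]
  have hcard : Fintype.card (Fin (Module.finrank F (Fin d → F))) = d := by
    rw [Fintype.card_fin, Module.finrank_fin_fun]
  rw [hcard] at h
  refine le_of_eq_of_le (congrArg norm ?_) h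
  congr 1
  · congr 1
    refine Finset.sum_congr rfl fun x _ => ?_
    change _ = if ∑ i, (w i : F) * e x i ^ 2 = t then
      φ (e.symm.toLinearEquiv.toAddMonoidHom (e x)) else 0
    rw [hval, hsymm]
  · refine Finset.sum_congr rfl fun x _ => ?_
    change _ = φ (e.symm.toLinearEquiv.toAddMonoidHom (e x))
    rw [hsymm]

theorem sum_neg_eq_conj {V : Type} [AddCommGroup V] [Finite V] (φ : AddChar V ℂ) (E : Finset V) :
    ∑ x ∈ E, φ (-x) = starRingEnd ℂ (∑ x ∈ E, φ x) := by
  rw [map_sum]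
  exact Finset.sum_congr rfl fun x _ => AddChar.map_neg_eq_conj φ x

section FourierCounting

variable {V : Type} [AddCommGroup V] [Fintype V] [DecidableEq V]

theorem card_mul_card_sum_mem (E S : Finset V) (k : ℕ) :
    (Fintype.card V : ℂ) * #{x ∈ Fintype.piFinset fun _ : Fin k => E | ∑ i, x i ∈ S} =
      ∑ φ : AddChar V ℂ, (∑ s ∈ S, φ (-s)) * (∑ x ∈ E, φ x) ^ k := by
  have hpow : ∀ φ : AddChar V ℂ, (∑ s ∈ S, φ (-s)) * (∑ x ∈ E, φ x) ^ k =
      ∑ x ∈ Fintype.piFinset fun _ : Fin k => E, ∑ s ∈ S, φ (∑ i, x i - s) := by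
    intro φ
    have : (∑ x ∈ E, φ x) ^ k = ∏ _i : Fin k, ∑ x ∈ E, φ x := by simp
    rw [this, Finset.prod_univ_sum, Finset.mul_sum]
    refine Finset.sum_congr rfl fun x _ => ?_
    rw [← addChar_map_sum, Finset.sum_mul]
    refine Finset.sum_congr rfl fun s _ => ?_
    rw [← AddChar.map_add_eq_mul, neg_add_eq_sub]
  simp_rw [hpow]
  rw [Finset.sum_comm, Finset.card_filter, Nat.cast_sum, Finset.mul_sum]
  refine Finset.sum_congr rfl fun x _ => ?_
  rw [Finset.sum_comm]
  simp_rw [AddChar.sum_apply_eq_ite, sub_eq_zero]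
  simp

theorem energy_eq_card (E : Finset V) (k : ℕ) :
    energy E k = #{x ∈ Fintype.piFinset fun _ : Fin k => E |
      ∑ i : Fin k with i.val < k / 2, x i = ∑ i : Fin k with ¬ i.val < k / 2, x i} := by
  rw [energy, Nat.card_eq_fintype_card, Fintype.card_subtype]
  congr 1
  ext x
  simp [Fintype.mem_piFinset]

theorem card_mul_energy (E : Finset V) {k : ℕ} (hk : Even k) :
    (Fintype.card V : ℝ) * energy E k = ∑ φ : AddChar V ℂ, ‖∑ x ∈ E, φ x‖ ^ k := by
  have hcard : #{i : Fin k | (i : ℕ) < k / 2} = k / 2 := by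
    rw [Fin.card_filter_val_lt]
    omega
  have hcard' : #{i : Fin k | ¬ (i : ℕ) < k / 2} = k / 2 := by
    have h := Finset.card_filter_add_card_filter_not (s := (Finset.univ : Finset (Fin k)))
      (fun i : Fin k => (i : ℕ) < k / 2)
    rw [hcard, Finset.card_univ, Fintype.card_fin] at h
    obtain ⟨m, rfl⟩ := hk
    omega
  have hpow : ∀ φ : AddChar V ℂ, ((‖∑ x ∈ E, φ x‖ ^ k : ℝ) : ℂ) =
      ∑ x ∈ Fintype.piFinset fun _ : Fin k => E,
        φ (∑ i : Fin k with i.val < k / 2, x i - ∑ i : Fin k with ¬ i.val < k / 2, x i) := by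
    intro φ
    have h1 : ((‖∑ x ∈ E, φ x‖ ^ k : ℝ) : ℂ) =
        ∏ i : Fin k, ∑ x ∈ E, if (i : ℕ) < k / 2 then φ x else φ (-x) := by
      have : ∀ i : Fin k, (∑ x ∈ E, if (i : ℕ) < k / 2 then φ x else φ (-x)) =
          if (i : ℕ) < k / 2 then ∑ x ∈ E, φ x else ∑ x ∈ E, φ (-x) := fun i => by
        split_ifs <;> rfl
      simp_rw [this]
      rw [Finset.prod_ite, Finset.prod_const, Finset.prod_const, hcard, hcard', ← mul_pow,
        sum_neg_eq_conj, Complex.mul_conj', ← pow_mul, Nat.mul_div_cancel' hk.two_dvd,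
        Complex.ofReal_pow]
    rw [h1, Finset.prod_univ_sum]
    refine Finset.sum_congr rfl fun x _ => ?_
    rw [Finset.prod_ite, sub_eq_add_neg, ← Finset.sum_neg_distrib, AddChar.map_add_eq_mul,
      addChar_map_sum, addChar_map_sum]
  have h : (((Fintype.card V : ℝ) * energy E k : ℝ) : ℂ) =
      ((∑ φ : AddChar V ℂ, ‖∑ x ∈ E, φ x‖ ^ k : ℝ) : ℂ) := by
    rw [Complex.ofReal_sum]
    simp_rw [hpow]
    rw [Finset.sum_comm]
    simp_rw [AddChar.sum_apply_eq_ite, sub_eq_zero]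
    rw [energy_eq_card, Finset.card_filter, Complex.ofReal_mul, Complex.ofReal_natCast,
      Complex.ofReal_natCast, Nat.cast_sum, Finset.mul_sum]
    refine Finset.sum_congr rfl fun x _ => ?_
    rw [Nat.cast_ite, Nat.cast_one, Nat.cast_zero, mul_ite, mul_one, mul_zero]
  exact_mod_cast h

/-- A set whose Fourier transform is close to that of a multiple of the uniform measure captures
about the expected number of `k`-fold sums, with an error controlled by the `k`-energy. -/
theorem abs_mul_card_sum_mem_sub_le (E S : Finset V) {k : ℕ} (hk : Even k) {r : ℕ} {B : ℝ}
    (hB : ∀ φ : AddChar V ℂ, ‖(r : ℂ) * ∑ s ∈ S, φ s - ∑ s, φ s‖ ≤ B) :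
    |(r : ℝ) * #{x ∈ Fintype.piFinset fun _ : Fin k => E | ∑ i, x i ∈ S} - (#E : ℝ) ^ k| ≤
      B * energy E k := by
  have hV : (0 : ℝ) < Fintype.card V := by exact_mod_cast Fintype.card_pos
  set N := #{x ∈ Fintype.piFinset fun _ : Fin k => E | ∑ i, x i ∈ S}
  have hN := card_mul_card_sum_mem E S k
  have hE := card_mul_card_sum_mem E univ k
  have huniv : #{x ∈ Fintype.piFinset fun _ : Fin k => E | ∑ i, x i ∈ univ} = #E ^ k := by
    simp
  rw [huniv, Nat.cast_pow] at hE
  have hdiff : (Fintype.card V : ℂ) * ((r : ℂ) * N - (#E : ℂ) ^ k) =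
      ∑ φ : AddChar V ℂ, ((r : ℂ) * ∑ s ∈ S, φ⁻¹ s - ∑ s, φ⁻¹ s) * (∑ x ∈ E, φ x) ^ k := by
    simp only [AddChar.inv_apply, sub_mul, Finset.sum_sub_distrib, mul_assoc,
      ← Finset.mul_sum]
    rw [← hN, ← hE]
    ring
  have hnorm := congrArg norm hdiff
  rw [norm_mul, Complex.norm_natCast] at hnorm
  have hreal : ‖(r : ℂ) * N - (#E : ℂ) ^ k‖ = |(r : ℝ) * N - (#E : ℝ) ^ k| := by
    rw [← Real.norm_eq_abs, ← Complex.norm_real]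
    push_cast
    rfl
  rw [hreal] at hnorm
  refine le_of_mul_le_mul_left ?_ hV
  rw [hnorm, mul_left_comm, card_mul_energy E hk, Finset.mul_sum]
  refine (norm_sum_le _ _).trans (Finset.sum_le_sum fun φ _ => ?_)
  rw [norm_mul, norm_pow]
  exact mul_le_mul_of_nonneg_right (hB φ⁻¹) (by positivity)

end FourierCounting

/-- If `q^{(d+1)/2} Λ_k(E) = o(|E|^k)` (even `k`), then `ν_k(t) = (1+o(1))|E|^k/q`. -/
theorem stmt7 (d : ℕ) (hd : 2 ≤ d) :
    ∀ ε : ℝ, 0 < ε → ∃ δ : ℝ, 0 < δ ∧ ∃ q₀ : ℕ,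
      ∀ (F : Type) [Field F] [Fintype F],
        Odd (Fintype.card F) → q₀ ≤ Fintype.card F →
        ∀ Q : QuadraticForm F (Fin d → F),
          LinearMap.Nondegenerate (QuadraticMap.polarBilin Q) →
        ∀ E : Finset (Fin d → F), ∀ k : ℕ, 2 ≤ k → Even k →
        (Fintype.card F : ℝ) ^ (((d : ℝ) + 1) / 2) * (energy E k : ℝ) ≤ δ * (E.card : ℝ) ^ k →
        ∀ t : F, t ≠ 0 →
        |(nuQ Q E k t : ℝ) - (E.card : ℝ) ^ k / (Fintype.card F : ℝ)| ≤
          ε * (E.card : ℝ) ^ k / (Fintype.card F : ℝ) := by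
  intro ε hε
  refine ⟨ε / 2, by positivity, 0, ?_⟩
  intro F _ _ hodd _ Q hQ E k _ hk hE t ht
  classical
  have hF : ringChar F ≠ 2 := by
    intro h
    have := FiniteField.even_card_of_char_two h
    rw [Nat.odd_iff] at hodd
    omega
  set q := Fintype.card F with hq
  have hqpos : (0 : ℝ) < q := by exact_mod_cast Fintype.card_pos
  have hnu : nuQ Q E k t = #{x ∈ Fintype.piFinset fun _ : Fin k => E |
      ∑ i, x i ∈ ({y | Q y = t} : Finset (Fin d → F))} := by
    rw [nuQ, Nat.card_eq_fintype_card, Fintype.card_subtype]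
    congr 1
    ext x
    simp [Fintype.mem_piFinset]
  have hmain := abs_mul_card_sum_mem_sub_le E ({y | Q y = t} : Finset (Fin d → F)) hk
    (fun φ => norm_sum_level_sub_le hF Q hQ ht φ)
  rw [← hnu, ← hq] at hmain
  have hpow : (q : ℝ) ^ (((d : ℝ) + 1) / 2) = √q ^ d * √q := by
    rw [← pow_succ, Real.sqrt_eq_rpow, ← Real.rpow_natCast, ← Real.rpow_mul hqpos.le]
    congr 1
    push_cast
    ring
  rw [hpow] at hE
  have hscale : (nuQ Q E k t : ℝ) - (#E : ℝ) ^ k / q = (q * nuQ Q E k t - (#E : ℝ) ^ k) / q := by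
    field_simp
  rw [hscale, abs_div, abs_of_pos hqpos]
  refine div_le_div_of_nonneg_right ?_ hqpos.le
  linarith
end

section
/- Let d ≥ 2. For every ε > 0 there exist δ > 0 and q₀ such that for every odd prime power q ≥ q₀, every non-degenerate quadratic form Q on F_q^d, every E ⊆ F_q^d and every odd integer k ≥ 3: if q^{(d+1)/2}·(Λ_{k−1}(E))^{1/2}·(Λ_{k+1}(E))^{1/2} ≤ δ·|E|^k, then for every t ∈ F_q∖{0} one has |ν_k(t) − |E|^k/q| ≤ ε·|E|^k/q. -/
open Finset

namespace Stepanov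

open Polynomial

variable {L : Type*} [Field L]

/-- All coefficients of the bivariate polynomial `h` have degree at most `d` in the inner
variable. -/
def CoeffDegLE (h : L[X][X]) (d : ℕ) : Prop := ∀ k, (h.coeff k).natDegree ≤ d

lemma CoeffDegLE.mono {h : L[X][X]} {d e : ℕ} (hd : CoeffDegLE h d) (hde : d ≤ e) :
    CoeffDegLE h e := fun k => (hd k).trans hde

lemma CoeffDegLE.add {h₁ h₂ : L[X][X]} {d : ℕ} (H₁ : CoeffDegLE h₁ d) (H₂ : CoeffDegLE h₂ d) :
    CoeffDegLE (h₁ + h₂) d := fun k => by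
  rw [coeff_add]; exact natDegree_add_le_of_degree_le (H₁ k) (H₂ k)

lemma CoeffDegLE.sum {ι : Type*} {s : Finset ι} {h : ι → L[X][X]} {d : ℕ}
    (H : ∀ i ∈ s, CoeffDegLE (h i) d) : CoeffDegLE (∑ i ∈ s, h i) d := fun k => by
  rw [finsetSum_coeff]
  exact natDegree_sum_le_of_forall_le _ _ fun i hi => H i hi k

lemma CoeffDegLE.mul {h₁ h₂ : L[X][X]} {d e : ℕ} (H₁ : CoeffDegLE h₁ d) (H₂ : CoeffDegLE h₂ e) :
    CoeffDegLE (h₁ * h₂) (d + e) := fun k => by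
  rw [coeff_mul]
  exact natDegree_sum_le_of_forall_le _ _ fun i _ => natDegree_mul_le_of_le (H₁ _) (H₂ _)

lemma CoeffDegLE.C {f : L[X]} {d : ℕ} (hf : f.natDegree ≤ d) :
    CoeffDegLE (Polynomial.C f) d := fun k => by
  rw [coeff_C]; split_ifs
  · exact hf
  · simp

lemma coeffDegLE_X_pow (n : ℕ) : CoeffDegLE (X ^ n : L[X][X]) 0 := fun k => by
  rw [coeff_X_pow]; split_ifs <;> simp

lemma CoeffDegLE.pow {h : L[X][X]} {d : ℕ} (H : CoeffDegLE h d) (n : ℕ) :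
    CoeffDegLE (h ^ n) (n * d) := by
  induction n with
  | zero => simpa using coeffDegLE_X_pow (L := L) 0
  | succ n ih => rw [pow_succ, Nat.succ_mul]; exact ih.mul H

/-- The `k`-th coefficient of the reduction of `h` (of degree at most `2 * p - 2`) modulo
`Y ^ p = X ^ (p - 1) * Y + f`. -/
noncomputable def reduce (p : ℕ) (f : L[X]) (k : ℕ) : L[X][X] →ₗ[L] L[X] where
  toFun h := h.coeff k + (if k = 0 then 0 else X ^ (p - 1) * h.coeff (p + k - 1)) +
    f * h.coeff (p + k)
  map_add' g h := by
    split_ifs <;> simp <;> ring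
  map_smul' r h := by
    split_ifs <;> simp

lemma reduce_apply (p : ℕ) (f : L[X]) (k : ℕ) (h : L[X][X]) :
    reduce p f k h = h.coeff k + (if k = 0 then 0 else X ^ (p - 1) * h.coeff (p + k - 1)) +
    f * h.coeff (p + k) := rfl

lemma natDegree_reduce_le {p : ℕ} {f : L[X]} (hf : f.natDegree ≤ p + 1) (k : ℕ) {h : L[X][X]}
    {d : ℕ} (H : CoeffDegLE h d) : (reduce p f k h).natDegree ≤ p + 1 + d := by
  rw [reduce_apply]
  refine natDegree_add_le_of_degree_le (natDegree_add_le_of_degree_le ?_ ?_) ?_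
  · exact (H k).trans (by omega)
  · split_ifs
    · simp
    · refine natDegree_mul_le_of_le ?_ (H _)
      rw [natDegree_X_pow]; omega
  · exact natDegree_mul_le_of_le hf (H _)

lemma eval₂_eq_sum_reduce {K : Type*} [Field K] (φ : L[X] →+* K) {p : ℕ} (hp : 0 < p) (f : L[X])
    {w : K} (hw : w ^ p = φ X ^ (p - 1) * w + φ f) {h : L[X][X]} (hh : h.natDegree + 2 ≤ 2 * p) :
    h.eval₂ φ w = ∑ k ∈ range p, φ (reduce p f k h) * w ^ k := by
  obtain ⟨r, rfl⟩ : ∃ r, p = r + 1 := ⟨p - 1, by omega⟩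
  rw [eval₂_eq_sum_range' φ (n := (r + 1) + (r + 1)) (by omega), sum_range_add]
  have h1 : ∀ k ∈ range (r + 1), φ (h.coeff (r + 1 + k)) * w ^ (r + 1 + k) =
      φ X ^ r * φ (h.coeff (r + 1 + k)) * w ^ (k + 1) + φ f * φ (h.coeff (r + 1 + k)) * w ^ k := by
    intro k _
    rw [pow_add, hw, Nat.add_sub_cancel]; ring
  have h0 : h.coeff (r + 1 + r) = 0 := coeff_eq_zero_of_natDegree_lt (by omega)
  have h2 : ∑ k ∈ range (r + 1), φ X ^ r * φ (h.coeff (r + 1 + k)) * w ^ (k + 1) =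
      ∑ k ∈ range (r + 1), φ (if k = 0 then 0 else X ^ r * h.coeff (r + 1 + k - 1)) * w ^ k := by
    rw [sum_range_succ, h0, sum_range_succ']
    simp [← add_assoc]
  rw [sum_congr rfl h1, sum_add_distrib, h2, ← sum_add_distrib, ← sum_add_distrib]
  refine sum_congr rfl fun k _ => ?_
  simp only [reduce_apply, map_add, map_mul, Nat.add_sub_cancel]
  ring

/-- The polynomial representing the `R`-th power of the outer variable. -/
noncomputable def frobPoly (R : ℕ) (A : L[X]) : L[X][X] := C (X ^ (R - 1)) * X + C A

lemma coeffDegLE_frobPoly {R S : ℕ} {A : L[X]} (hA : A.natDegree = R + S) :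
    CoeffDegLE (frobPoly R A) (R + S) := by
  refine CoeffDegLE.add ?_ (CoeffDegLE.C hA.le)
  have := (CoeffDegLE.C (f := (X ^ (R - 1) : L[X])) (d := R + S)
    (by rw [natDegree_X_pow]; omega)).mul (coeffDegLE_X_pow 1)
  simpa using this

lemma natDegree_frobPoly_le (R : ℕ) (A : L[X]) : (frobPoly R A).natDegree ≤ 1 :=
  natDegree_linear_le

lemma coeffDegLE_frobPoly_pow_sub {R S : ℕ} {A : L[X]} (hR : 0 < R) (hA : A.natDegree = R + S)
    (j : ℕ) : CoeffDegLE (frobPoly R A ^ j - C (A ^ j)) (j * (R + S) - (S + 1)) := by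
  induction j with
  | zero => intro k; simp
  | succ j ih =>
    have hsplit : frobPoly R A ^ (j + 1) - C (A ^ (j + 1)) =
        frobPoly R A * (frobPoly R A ^ j - C (A ^ j)) + C (X ^ (R - 1)) * X ^ 1 * C (A ^ j) := by
      simp only [frobPoly, map_pow]; ring
    rw [hsplit]
    have hAj : (A ^ j).natDegree ≤ j * (R + S) :=
      natDegree_pow_le_of_le j hA.le
    have h2 : CoeffDegLE (C (X ^ (R - 1)) * X ^ 1 * C (A ^ j) : L[X][X])
        ((j + 1) * (R + S) - (S + 1)) := by
      refine (((CoeffDegLE.C (natDegree_X_pow_le (R - 1))).mul (coeffDegLE_X_pow 1)).mul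
        (CoeffDegLE.C hAj)).mono ?_
      rw [Nat.succ_mul]; omega
    refine CoeffDegLE.add ?_ h2
    rcases Nat.eq_zero_or_pos j with rfl | hj
    · intro k; simp
    · refine ((coeffDegLE_frobPoly hA).mul ih).mono ?_
      have : R + S ≤ j * (R + S) := Nat.le_mul_of_pos_left _ hj
      rw [Nat.succ_mul]; omega

/-- The `R`-th power of the `n`-th monomial `X ^ (n / p + (p - 1 - n % p)) * Y ^ (n % p)`. -/
noncomputable def monoPow (p R : ℕ) (A : L[X]) (n : ℕ) : L[X][X] :=
  C (X ^ ((n / p + (p - 1 - n % p)) * R)) * frobPoly R A ^ (n % p)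

lemma weight_eq {p S : ℕ} (hp : 0 < p) (n : ℕ) :
    (n / p + (p - 1 - n % p)) * (p * S) + n % p * (p * S + S) = (p - 1) * (p * S) + n * S := by
  have h1 : n % p < p := Nat.mod_lt _ hp
  obtain ⟨e, he⟩ : ∃ e, p - 1 = e + n % p := ⟨p - 1 - n % p, by omega⟩
  have h2 := Nat.div_add_mod n p
  rw [he, Nat.add_sub_cancel]
  have h3 : n * S = (p * (n / p) + n % p) * S := by rw [h2]
  rw [h3]
  ring

lemma coeffDegLE_monoPow {p S : ℕ} {A : L[X]} (hp : 0 < p) (hA : A.natDegree = p * S + S) (n : ℕ) :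
    CoeffDegLE (monoPow p (p * S) A n) ((p - 1) * (p * S) + n * S) := by
  rw [← weight_eq hp]
  exact (CoeffDegLE.C (natDegree_X_pow_le _)).mul ((coeffDegLE_frobPoly hA).pow _)

lemma natDegree_monoPow_le (p R : ℕ) (A : L[X]) (n : ℕ) (hp : 0 < p) :
    (monoPow p R A n).natDegree ≤ p - 1 := by
  have := Nat.mod_lt n hp
  refine (natDegree_C_mul_le _ _).trans ((natDegree_pow_le_of_le _
    (natDegree_frobPoly_le R A)).trans (by omega))

/-- The constant (in the outer variable) part of `monoPow`. -/
noncomputable def monoLead (p R : ℕ) (A : L[X]) (n : ℕ) : L[X] :=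
  X ^ ((n / p + (p - 1 - n % p)) * R) * A ^ (n % p)

lemma natDegree_monoLead {p S : ℕ} {A : L[X]} (hp : 0 < p) (hS : 0 < S)
    (hA : A.natDegree = p * S + S) (n : ℕ) :
    (monoLead p (p * S) A n).natDegree = (p - 1) * (p * S) + n * S := by
  have hA0 : A ≠ 0 := by rintro rfl; simp at hA; omega
  rw [← weight_eq hp, monoLead, natDegree_mul (pow_ne_zero _ X_ne_zero) (pow_ne_zero _ hA0),
    natDegree_X_pow, natDegree_pow, hA]

lemma coeffDegLE_monoPow_sub {p S : ℕ} {A : L[X]} (hp : 2 ≤ p) (hS : 0 < S)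
    (hA : A.natDegree = p * S + S) (n : ℕ) :
    CoeffDegLE (monoPow p (p * S) A n - C (monoLead p (p * S) A n))
      ((p - 1) * (p * S) + n * S - S) := by
  have hsplit : monoPow p (p * S) A n - C (monoLead p (p * S) A n) =
      C (X ^ ((n / p + (p - 1 - n % p)) * (p * S))) *
        (frobPoly (p * S) A ^ (n % p) - C (A ^ (n % p))) := by
    simp only [monoPow, monoLead, map_mul]; ring
  have hw := weight_eq (S := S) (by omega : 0 < p) n
  rcases Nat.eq_zero_or_pos (n % p) with h0 | h0
  · intro k; rw [hsplit, h0]; simp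
  · rw [hsplit]
    refine ((CoeffDegLE.C (natDegree_X_pow_le _)).mul
      (coeffDegLE_frobPoly_pow_sub (by positivity) hA _)).mono ?_
    have : p * S + S ≤ n % p * (p * S + S) := Nat.le_mul_of_pos_left _ h0
    have : S ≤ p * S := Nat.le_mul_of_pos_left _ (by omega)
    omega

/-- The auxiliary polynomial with coefficients `u`. -/
noncomputable def auxPoly (p R : ℕ) (A : L[X]) (N : ℕ) (u : ℕ → ℕ → L[X]) : L[X][X] :=
  ∑ n ∈ range N, ∑ l ∈ range p, C (u n l) * X ^ l * monoPow p R A n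

lemma coeffDegLE_auxPoly_term {p S : ℕ} {A : L[X]} (hp : 0 < p) (hA : A.natDegree = p * S + S)
    {b : ℕ} {f : L[X]} (hf : f.natDegree ≤ b) (n l : ℕ) :
    CoeffDegLE (C f * X ^ l * monoPow p (p * S) A n) (b + ((p - 1) * (p * S) + n * S)) := by
  simpa using ((CoeffDegLE.C hf).mul (coeffDegLE_X_pow l)).mul (coeffDegLE_monoPow hp hA n)

lemma coeffDegLE_auxPoly {p S : ℕ} {A : L[X]} (hp : 0 < p) (hA : A.natDegree = p * S + S)
    {b N : ℕ} {u : ℕ → ℕ → L[X]} (hu : ∀ n l, (u n l).natDegree ≤ b) :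
    CoeffDegLE (auxPoly p (p * S) A N u) (b + ((p - 1) * (p * S) + N * S)) := by
  refine CoeffDegLE.sum fun n hn => CoeffDegLE.sum fun l _ =>
    (coeffDegLE_auxPoly_term hp hA (hu n l) n l).mono ?_
  have : n * S ≤ N * S := Nat.mul_le_mul_right _ (mem_range.1 hn).le
  omega

lemma natDegree_auxPoly_le {p R : ℕ} (hp : 0 < p) (A : L[X]) (N : ℕ) (u : ℕ → ℕ → L[X]) :
    (auxPoly p R A N u).natDegree + 2 ≤ 2 * p := by
  have : (auxPoly p R A N u).natDegree ≤ (p - 1) + (p - 1) := by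
    refine natDegree_sum_le_of_forall_le _ _ fun n _ => natDegree_sum_le_of_forall_le _ _
      fun l hl => natDegree_mul_le_of_le ?_ (natDegree_monoPow_le p R A n hp)
    have := mem_range.1 hl
    exact (natDegree_C_mul_X_pow_le _ _).trans (by omega)
  omega

/-- The reduction of a nontrivial auxiliary polynomial is nontrivial. -/
lemma exists_reduce_auxPoly_ne_zero {p S : ℕ} {A f : L[X]} (hp : 2 ≤ p)
    (hA : A.natDegree = p * S + S) (hf : f.natDegree ≤ p + 1) {b N : ℕ} (hb : b + p + 2 ≤ S)
    {u : ℕ → ℕ → L[X]} (hu : ∀ n l, (u n l).natDegree ≤ b)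
    (hne : ∃ n < N, ∃ l < p, u n l ≠ 0) :
    ∃ k < p, reduce p f k (auxPoly p (p * S) A N u) ≠ 0 := by
  classical
  have hp0 : 0 < p := by omega
  have hS : 0 < S := by omega
  obtain ⟨n, hn, hmax⟩ := ((range N).filter fun n => ∃ l < p, u n l ≠ 0).exists_max_image id
    (by obtain ⟨n, hn, h⟩ := hne; exact ⟨n, by simpa using ⟨hn, h⟩⟩)
  simp only [mem_filter, mem_range, id] at hn hmax
  obtain ⟨hnN, l, hl, hul⟩ := hn
  refine ⟨l, hl, ?_⟩
  have hzero : ∀ n' < N, n < n' → ∀ l' < p, u n' l' = 0 := by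
    intro n' hn' hlt l' hl'
    by_contra hc
    exact absurd (hmax n' ⟨hn', l', hl', hc⟩) (by omega)
  set G := monoLead p (p * S) A n
  set T := (p - 1) * (p * S) + n * S with hT
  have hGdeg : G.natDegree = T := natDegree_monoLead hp0 hS hA n
  have hST : S ≤ T := by
    have : 1 * (1 * S) ≤ (p - 1) * (p * S) := by gcongr <;> omega
    omega
  set main : L[X][X] := ∑ l ∈ range p, C (u n l * G) * X ^ l with hmain
  have hsplit : auxPoly p (p * S) A N u = (∑ n' ∈ range n, ∑ l ∈ range p,
      C (u n' l) * X ^ l * monoPow p (p * S) A n') +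
      (∑ l ∈ range p, C (u n l) * X ^ l * (monoPow p (p * S) A n - C G)) + main := by
    have : N = n + 1 + (N - (n + 1)) := by omega
    rw [auxPoly, this, sum_range_add, sum_range_succ]
    rw [sum_eq_zero (s := range (N - (n + 1))), add_zero, add_assoc]
    · congr 1
      rw [hmain, ← sum_add_distrib]
      refine sum_congr rfl fun l _ => ?_
      rw [map_mul]; ring
    · intro i hi
      refine sum_eq_zero fun l hl => ?_
      rw [hzero _ (by have := mem_range.1 hi; omega) (by omega) l (mem_range.1 hl)]
      simp
  have hlow : CoeffDegLE ((∑ n' ∈ range n, ∑ l ∈ range p,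
      C (u n' l) * X ^ l * monoPow p (p * S) A n') +
      (∑ l ∈ range p, C (u n l) * X ^ l * (monoPow p (p * S) A n - C G))) (b + (T - S)) := by
    refine CoeffDegLE.add (CoeffDegLE.sum fun n' hn' => CoeffDegLE.sum fun l _ =>
      (coeffDegLE_auxPoly_term hp0 hA (hu n' l) n' l).mono ?_) (CoeffDegLE.sum fun l _ => ?_)
    · have : (n' + 1) * S ≤ n * S := Nat.mul_le_mul_right _ (mem_range.1 hn')
      rw [Nat.succ_mul] at this
      omega
    · simpa using ((CoeffDegLE.C (hu n l)).mul (coeffDegLE_X_pow l)).mul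
        (coeffDegLE_monoPow_sub hp hS hA n)
  have hcoeff : ∀ k, main.coeff k = if k < p then u n k * G else 0 := by
    intro k
    simp [hmain, finsetSum_coeff, -map_mul, coeff_C_mul, coeff_X_pow]
  have hred : reduce p f l main = u n l * G := by
    rw [reduce_apply, hcoeff, hcoeff, hcoeff, if_pos hl, if_neg (show ¬ p + l < p by omega)]
    split_ifs <;> first | omega | simp
  rw [hsplit, map_add, hred]
  intro h0
  have hG0 : G ≠ 0 := by intro h; rw [h] at hGdeg; simp at hGdeg; omega
  have h1 : (u n l * G).natDegree ≤ p + 1 + (b + (T - S)) := by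
    rw [eq_neg_of_add_eq_zero_right h0, natDegree_neg]
    exact natDegree_reduce_le hf l hlow
  rw [natDegree_mul hul hG0, hGdeg] at h1
  omega

/-- The polynomial representing the `R`-th power of `X ^ k * Y ^ l` times the `n`-th monomial
evaluated at `Y + t * X`. -/
noncomputable def shiftedTerm (p R : ℕ) (A : L[X]) (t : L) (n l k : ℕ) : L[X][X] :=
  C (X ^ (k * R)) * frobPoly R A ^ l *
    (C (X ^ (n / p + (p - 1 - n % p))) * (X + C (C t * X)) ^ (n % p))

lemma natDegree_shiftedTerm_le {p : ℕ} (hp : 0 < p) (R : ℕ) (A : L[X]) (t : L) (n k : ℕ) {l : ℕ}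
    (hl : l < p) : (shiftedTerm p R A t n l k).natDegree ≤ (p - 1) + (p - 1) := by
  have := Nat.mod_lt n hp
  refine natDegree_mul_le_of_le ?_ ?_
  · refine (natDegree_C_mul_le _ _).trans ((natDegree_pow_le_of_le _
      (natDegree_frobPoly_le R A)).trans (by omega))
  · refine (natDegree_C_mul_le _ _).trans ((natDegree_pow_le_of_le _
      (natDegree_X_add_C _).le).trans (by omega))

lemma coeffDegLE_shiftedTerm {p S : ℕ} (hp : 0 < p) {A : L[X]} (hA : A.natDegree = p * S + S)
    (t : L) {b I n l k : ℕ} (hn : n < I * p) (hl : l < p) (hk : k ≤ b) :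
    CoeffDegLE (shiftedTerm p (p * S) A t n l k)
      (b * (p * S) + (p - 1) * (p * S + S) + (I + (p - 1) + (p - 1))) := by
  have h1 := Nat.mod_lt n hp
  have h2 : n / p < I := Nat.div_lt_of_lt_mul (by rwa [mul_comm])
  have hX : CoeffDegLE (X + C (C t * X) : L[X][X]) 1 := by
    refine CoeffDegLE.add ?_ (CoeffDegLE.C ((natDegree_C_mul_le _ _).trans natDegree_X_le))
    simpa using (coeffDegLE_X_pow (L := L) 1).mono zero_le_one
  refine (((CoeffDegLE.C (natDegree_X_pow_le _)).mul ((coeffDegLE_frobPoly hA).pow l)).mul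
    ((CoeffDegLE.C (natDegree_X_pow_le _)).mul (hX.pow (n % p)))).mono ?_
  have h3 : k * (p * S) ≤ b * (p * S) := Nat.mul_le_mul_right _ hk
  have h4 : l * (p * S + S) ≤ (p - 1) * (p * S + S) := Nat.mul_le_mul_right _ (by omega)
  omega

/-- A nontrivial solution of the linear system expressing the vanishing of the reduction. -/
lemma exists_reduce_shiftedTerm_eq_zero {p S : ℕ} (hp : 0 < p) {A f : L[X]}
    (hA : A.natDegree = p * S + S) (hf : f.natDegree ≤ p + 1) (t : L) {b I : ℕ}
    (hcount : b * (p * S) + (p - 1) * (p * S + S) + (I + (p - 1) + (p - 1)) + (p + 2) <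
      I * p * (b + 1)) :
    ∃ v : ℕ → ℕ → ℕ → L, (∃ n < I * p, ∃ l < p, ∃ k < b + 1, v n l k ≠ 0) ∧
      ∀ k < p, reduce p f k (∑ n ∈ range (I * p), ∑ l ∈ range p, ∑ k ∈ range (b + 1),
        v n l k • shiftedTerm p (p * S) A t n l k) = 0 := by
  set d := b * (p * S) + (p - 1) * (p * S + S) + (I + (p - 1) + (p - 1)) with hd
  let Ψ : Fin (I * p) × Fin p × Fin (b + 1) → L[X][X] := fun i =>
    shiftedTerm p (p * S) A t i.1 i.2.1 i.2.2
  let T : L[X][X] →ₗ[L] (Fin p × Fin (d + (p + 2)) → L) :=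
    LinearMap.pi fun i => (lcoeff L i.2).comp (reduce p f i.1)
  have hker := LinearMap.ker_ne_bot_of_finrank_lt (f := T.comp (Fintype.linearCombination L Ψ))
    (by
      simp only [Module.finrank_pi, Fintype.card_prod, Fintype.card_fin]
      calc p * (d + (p + 2)) < p * (I * p * (b + 1)) := Nat.mul_lt_mul_of_pos_left hcount hp
        _ = _ := by ring)
  obtain ⟨v, hv, hv0⟩ := Submodule.exists_mem_ne_zero_of_ne_bot hker
  rw [LinearMap.mem_ker] at hv
  obtain ⟨⟨n, l, k⟩, hi⟩ := Function.ne_iff.1 hv0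
  refine ⟨fun n l k => if h : n < I * p ∧ l < p ∧ k < b + 1 then
    v (⟨n, h.1⟩, ⟨l, h.2.1⟩, ⟨k, h.2.2⟩) else 0, ⟨n, n.2, l, l.2, k, k.2, by
      simp only [dif_pos (show (n : ℕ) < I * p ∧ (l : ℕ) < p ∧ (k : ℕ) < b + 1 from
        ⟨n.2, l.2, k.2⟩)]
      exact hi⟩, ?_⟩
  have hsum : (∑ n ∈ range (I * p), ∑ l ∈ range p, ∑ k ∈ range (b + 1),
      (if h : n < I * p ∧ l < p ∧ k < b + 1 then
        v (⟨n, h.1⟩, ⟨l, h.2.1⟩, ⟨k, h.2.2⟩) else 0) • shiftedTerm p (p * S) A t n l k) =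
      Fintype.linearCombination L Ψ v := by
    rw [Fintype.linearCombination_apply, Fintype.sum_prod_type, sum_range]
    refine sum_congr rfl fun n _ => ?_
    rw [Fintype.sum_prod_type, sum_range]
    refine sum_congr rfl fun l _ => ?_
    rw [sum_range]
    refine sum_congr rfl fun k _ => ?_
    rw [dif_pos ⟨n.2, l.2, k.2⟩]
  intro k hk
  rw [hsum]
  ext e
  rw [coeff_zero]
  by_cases he : e < d + (p + 2)
  · exact congrFun hv (⟨k, hk⟩, ⟨e, he⟩)
  · refine coeff_eq_zero_of_natDegree_lt (lt_of_le_of_lt (natDegree_reduce_le hf k (d := d) ?_)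
      (by omega))
    rw [Fintype.linearCombination_apply]
    refine CoeffDegLE.sum fun i _ => ?_
    have := (CoeffDegLE.C (d := 0) (natDegree_C (v i)).le).mul
      (coeffDegLE_shiftedTerm hp hA t i.1.2 i.2.1.2 (Nat.lt_succ_iff.1 i.2.2.2))
    rw [zero_add] at this
    have hs : v i • Ψ i = C (C (v i)) * Ψ i := by
      ext; simp
    rw [hs]
    exact this

/-- The auxiliary polynomial vanishes at the points of the curve. -/
lemma eval₂_auxPoly_eq_zero {K : Type*} [Field K] [Algebra L K] {p m : ℕ} [Fact p.Prime] [CharP K p]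
    {A f : L[X]} {t x : L} {w : K} {b N : ℕ} {v : ℕ → ℕ → ℕ → L}
    (hL : ∀ z : L, z ^ (p ^ m * p ^ m) = z)
    (hv : ∀ k < p, reduce p f k (∑ n ∈ range N, ∑ l ∈ range p, ∑ k ∈ range (b + 1),
        v n l k • shiftedTerm p (p ^ m) A t n l k) = 0)
    (hw : w ^ p = algebraMap L K x ^ (p - 1) * w + algebraMap L K (f.eval x))
    (hwR : w ^ p ^ m = algebraMap L K x ^ (p ^ m - 1) * w + algebraMap L K (A.eval x))
    (hwQ : (w ^ p ^ m) ^ p ^ m = w + algebraMap L K (t * x)) :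
    (auxPoly p (p ^ m) A N fun n l => ∑ k ∈ range (b + 1), C (v n l k ^ p ^ m) * X ^ k).eval₂
      ((algebraMap L K).comp (evalRingHom x)) w = 0 := by
  have hp : 0 < p := (Fact.out : p.Prime).pos
  set φ := (algebraMap L K).comp (evalRingHom x) with hφ
  have hφX : φ X = algebraMap L K x := by simp [hφ]
  have hφC : ∀ a, φ (C a) = algebraMap L K a := by simp [hφ]
  have hφf : ∀ g, φ g = algebraMap L K (g.eval x) := by simp [hφ]
  rw [← coe_eval₂RingHom]
  set E := eval₂RingHom φ w with hE
  have hEC : ∀ g, E (C g) = φ g := by simp [hE]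
  have hEX : E X = w := by simp [hE]
  have hEV : E (frobPoly (p ^ m) A) = w ^ p ^ m := by
    rw [frobPoly, map_add, map_mul, hEC, hEC, hEX, map_pow, hφX, hwR, hφf]
  have hxQ : (algebraMap L K x ^ p ^ m) ^ p ^ m = algebraMap L K x := by
    rw [← pow_mul, ← map_pow, hL]
  have key : E (auxPoly p (p ^ m) A N
      fun n l => ∑ k ∈ range (b + 1), C (v n l k ^ p ^ m) * X ^ k) ^ p ^ m =
      E (∑ n ∈ range N, ∑ l ∈ range p, ∑ k ∈ range (b + 1),
        v n l k • shiftedTerm p (p ^ m) A t n l k) := by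
    rw [auxPoly, map_sum, sum_pow_char_pow, map_sum]
    refine sum_congr rfl fun n _ => ?_
    rw [map_sum, sum_pow_char_pow, map_sum]
    refine sum_congr rfl fun l _ => ?_
    rw [map_mul, map_mul, mul_pow, mul_pow, hEC, map_sum, sum_pow_char_pow, map_sum, sum_mul,
      sum_mul]
    refine sum_congr rfl fun k _ => ?_
    have hs : v n l k • shiftedTerm p (p ^ m) A t n l k =
      C (C (v n l k)) * shiftedTerm p (p ^ m) A t n l k := by ext; simp
    rw [hs, shiftedTerm, monoPow]
    simp only [map_mul, map_pow, map_add, hEC, hEX, hEV, hφX, hφC]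
    have h1 : ((algebraMap L K (v n l k) ^ p ^ m * algebraMap L K x ^ k) ^ p ^ m) =
        algebraMap L K (v n l k) * algebraMap L K x ^ (k * p ^ m) := by
      rw [mul_pow, ← pow_mul, ← map_pow, hL, ← pow_mul]
    have h2 : (algebraMap L K x ^ ((n / p + (p - 1 - n % p)) * p ^ m) *
        (w ^ p ^ m) ^ (n % p)) ^ p ^ m = algebraMap L K x ^ (n / p + (p - 1 - n % p)) *
        (w + algebraMap L K t * algebraMap L K x) ^ (n % p) := by
      rw [mul_pow, mul_comm _ (p ^ m), pow_mul, pow_right_comm, hxQ, pow_right_comm (w ^ p ^ m),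
        hwQ, map_mul]
    rw [h1, h2, pow_right_comm w]
    ring
  have hdeg : (∑ n ∈ range N, ∑ l ∈ range p, ∑ k ∈ range (b + 1),
        v n l k • shiftedTerm p (p ^ m) A t n l k).natDegree + 2 ≤ 2 * p := by
    have : (∑ n ∈ range N, ∑ l ∈ range p, ∑ k ∈ range (b + 1),
        v n l k • shiftedTerm p (p ^ m) A t n l k).natDegree ≤ (p - 1) + (p - 1) :=
      natDegree_sum_le_of_forall_le _ _ fun n _ => natDegree_sum_le_of_forall_le _ _
        fun l hl => natDegree_sum_le_of_forall_le _ _ fun k _ => (natDegree_smul_le _ _).trans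
          (natDegree_shiftedTerm_le hp _ _ _ _ _ (mem_range.1 hl))
    omega
  have h0 : E (∑ n ∈ range N, ∑ l ∈ range p, ∑ k ∈ range (b + 1),
        v n l k • shiftedTerm p (p ^ m) A t n l k) = 0 := by
    rw [hE, coe_eval₂RingHom, eval₂_eq_sum_reduce φ hp f (by rw [hw, hφX, hφf]) hdeg]
    refine sum_eq_zero fun k hk => ?_
    rw [hv k (mem_range.1 hk), map_zero, zero_mul]
  rw [h0] at key
  exact pow_eq_zero_iff (pow_pos hp m).ne' |>.1 key

/-- `X ^ (p ^ m) * ∑ i < m, (X + c / X) ^ (p ^ i)` as a polynomial in characteristic `p`. -/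
noncomputable def partialTrace (p m : ℕ) (c : L) : L[X] :=
  ∑ i ∈ range m, (X ^ (p ^ m + p ^ i) + C (c ^ p ^ i) * X ^ (p ^ m - p ^ i))

lemma natDegree_partialTrace {p : ℕ} (hp : 2 ≤ p) (m : ℕ) (c : L) :
    (partialTrace p (m + 1) c).natDegree = p ^ (m + 1) + p ^ m := by
  have hpos : 0 < p ^ m := by positivity
  have hterm : ∀ i, (C (c ^ p ^ i) * X ^ (p ^ (m + 1) - p ^ i) : L[X]).natDegree < p ^ (m + 1) + 1 :=
    fun i => lt_of_le_of_lt (natDegree_C_mul_X_pow_le _ _) (by omega)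
  refine le_antisymm (natDegree_sum_le_of_forall_le _ _ fun i hi =>
    natDegree_add_le_of_degree_le ?_ ((hterm i).le.trans (by omega))) (le_natDegree_of_ne_zero ?_)
  · rw [natDegree_X_pow]
    have : p ^ i ≤ p ^ m := Nat.pow_le_pow_right (by omega) (by simpa [Nat.lt_succ_iff] using hi)
    omega
  · rw [partialTrace, finsetSum_coeff, sum_eq_single m]
    · rw [coeff_add, coeff_X_pow_self, coeff_eq_zero_of_natDegree_lt
        ((hterm m).trans_le (by omega))]
      simp
    · intro i _ him
      rw [coeff_add, coeff_X_pow, coeff_eq_zero_of_natDegree_lt ((hterm i).trans_le (by omega)),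
        if_neg, add_zero]
      intro h
      exact him (Nat.pow_right_injective hp (by simpa using h.symm))
    · simp

lemma eval_partialTrace {p m : ℕ} [Fact p.Prime] [CharP L p] {x : L} (hx : x ≠ 0) (c : L) :
    (partialTrace p m c).eval x = x ^ p ^ m * ∑ i ∈ range m, (x + c / x) ^ p ^ i := by
  rw [partialTrace, eval_finsetSum, mul_sum]
  refine sum_congr rfl fun i hi => ?_
  have : p ^ i ≤ p ^ m :=
    Nat.pow_le_pow_right (Fact.out : p.Prime).pos (mem_range.1 hi).le
  rw [add_pow_char_pow, div_pow]
  simp only [eval_add, eval_mul, eval_pow, eval_X, eval_C, pow_add, pow_sub₀ _ hx this]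
  field_simp

lemma pow_char_pow_of_artinSchreier {K : Type*} [Field K] {p : ℕ} [Fact p.Prime] [CharP K p]
    {y z : K} (h : y ^ p = y + z) (m : ℕ) : y ^ p ^ m = y + ∑ i ∈ range m, z ^ p ^ i := by
  induction m with
  | zero => simp
  | succ m ih =>
    rw [pow_succ', pow_mul, h, add_pow_char_pow, ih, sum_range_succ, add_assoc]

lemma count_inequality {p S : ℕ} (hp : 2 ≤ p) (hS : 2 * (p + 1) ^ 2 ≤ S) :
    (S - p - 2) * (p * S) + (p - 1) * (p * S + S) + (S + p + 1 + (p - 1) + (p - 1)) + (p + 2) <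
      (S + p + 1) * p * (S - p - 2 + 1) := by
  obtain ⟨r, rfl⟩ : ∃ r, p = r + 2 := ⟨p - 2, by omega⟩
  obtain ⟨s, rfl⟩ : ∃ s, S = s + (r + 2) + 2 := ⟨S - (r + 2) - 2, by
    have : r + 4 ≤ 2 * (r + 2 + 1) ^ 2 := by nlinarith
    omega⟩
  have h1 : s + (r + 2) + 2 - (r + 2) - 2 = s := by omega
  have h2 : r + 2 - 1 = r + 1 := by omega
  rw [h1, h2]
  nlinarith [hS, Nat.mul_le_mul_left r hS]

/-- Stepanov's bound for the number of `x` for which `x + c / x` has a given trace. -/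
theorem card_filter_trace_le [Fintype L] [DecidableEq L] {p m : ℕ} [Fact p.Prime]
    [Algebra (ZMod p) L]
    (hcard : Fintype.card L = p ^ (m + 1) * p ^ (m + 1)) (hm : 2 * (p + 1) ^ 2 ≤ p ^ m)
    (c : L) (t : ZMod p) :
    #{x : L | x ≠ 0 ∧ Algebra.trace (ZMod p) L (x + c / x) = t} ≤
      p ^ m * p ^ (m + 1) + (2 * p + 1) * p ^ (m + 1) := by
  have hp2 : 2 ≤ p := (Fact.out : p.Prime).two_le
  have hp0 : 0 < p := by omega
  have hR : p ^ (m + 1) = p * p ^ m := pow_succ' p m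
  have : CharP L p := charP_of_injective_algebraMap (algebraMap (ZMod p) L).injective p
  let K := AlgebraicClosure L
  have : CharP K p := charP_of_injective_algebraMap (algebraMap L K).injective p
  set A := partialTrace p (m + 1) c
  have hA : A.natDegree = p * p ^ m + p ^ m := by rw [← hR]; exact natDegree_partialTrace hp2 m c
  set f : L[X] := X ^ (p + 1) + C c * X ^ (p - 1)
  have hf : f.natDegree ≤ p + 1 := natDegree_add_le_of_degree_le (natDegree_X_pow_le _)
    ((natDegree_C_mul_X_pow_le _ _).trans (by omega))
  have hb : p ^ m - p - 2 + p + 2 ≤ p ^ m := by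
    have : p + 2 ≤ 2 * (p + 1) ^ 2 := by nlinarith
    omega
  set b := p ^ m - p - 2
  set I := p ^ m + p + 1
  have hL : ∀ z : L, z ^ (p ^ (m + 1) * p ^ (m + 1)) = z := fun z => by
    rw [← hcard, FiniteField.pow_card]
  obtain ⟨v, ⟨n₀, hn₀, l₀, hl₀, k₀, hk₀, hv₀⟩, hv⟩ := exists_reduce_shiftedTerm_eq_zero hp0 hA hf
    (algebraMap (ZMod p) L t) (count_inequality hp2 hm)
  rw [← hR] at hv
  set u : ℕ → ℕ → L[X] := fun n l => ∑ k ∈ range (b + 1), C (v n l k ^ p ^ (m + 1)) * X ^ k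
  have hu : ∀ n l, (u n l).natDegree ≤ b := fun n l =>
    natDegree_sum_le_of_forall_le _ _ fun k hk => (natDegree_C_mul_X_pow_le _ _).trans
      (Nat.lt_succ_iff.1 (mem_range.1 hk))
  have hne : u n₀ l₀ ≠ 0 := by
    intro h
    have h1 : (u n₀ l₀).coeff k₀ = v n₀ l₀ k₀ ^ p ^ (m + 1) := by
      have hk₀' : k₀ < b + 1 := hk₀
      simp only [u, finsetSum_coeff, coeff_C_mul_X_pow]
      rw [sum_ite_eq, if_pos (mem_range.2 hk₀')]
    rw [h, coeff_zero] at h1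
    exact hv₀ (pow_eq_zero_iff (by positivity) |>.1 h1.symm)
  obtain ⟨k, hk, hk0⟩ := exists_reduce_auxPoly_ne_zero hp2 hA hf hb hu ⟨n₀, hn₀, l₀, hl₀, hne⟩
  have hdeg := natDegree_reduce_le (p := p) hf k (coeffDegLE_auxPoly (N := I * p) hp0 hA hu)
  rw [← hR] at hk0 hdeg
  set g := auxPoly p (p ^ (m + 1)) A (I * p) u
  have hroot : ∀ x ∈ ({x : L | x ≠ 0 ∧ Algebra.trace (ZMod p) L (x + c / x) = t} : Finset L),
      x ∈ (reduce p f k g).roots.toFinset := by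
    intro x hx
    obtain ⟨hx0, hxt⟩ := (mem_filter.1 hx).2
    rw [Multiset.mem_toFinset, mem_roots hk0, IsRoot]
    set a : K := algebraMap L K x with ha
    have ha0 : a ≠ 0 := by simpa [ha] using hx0
    obtain ⟨y, hy⟩ : ∃ y : K, y ^ p = y + algebraMap L K (x + c / x) := by
      have hdeg : (X ^ p - (X + C (algebraMap L K (x + c / x))) : K[X]).degree ≠ 0 := by
        rw [degree_sub_eq_left_of_degree_lt]
        · rw [degree_X_pow]; exact_mod_cast hp0.ne'
        · rw [degree_X_pow, degree_X_add_C]; exact_mod_cast hp2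
      obtain ⟨y, hy⟩ := IsAlgClosed.exists_root _ hdeg
      refine ⟨y, ?_⟩
      simpa [IsRoot, sub_eq_zero] using hy
    have htr : ∑ i ∈ range (m + 1 + (m + 1)), (algebraMap L K (x + c / x)) ^ p ^ i =
        algebraMap L K (algebraMap (ZMod p) L t) := by
      have h1 := FiniteField.algebraMap_trace_eq_sum_pow (ZMod p) L (x + c / x)
      have h2 : Module.finrank (ZMod p) L = m + 1 + (m + 1) := by
        have := Module.card_eq_pow_finrank (K := ZMod p) (V := L)
        rw [hcard, ZMod.card, ← pow_add] at this
        exact (Nat.pow_right_injective hp2 this).symm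
      rw [h2, hxt, Nat.card_zmod] at h1
      rw [h1, map_sum]
      simp only [map_pow]
    have hpoint : ∀ s : ZMod p,
        ∑ k ∈ range p, algebraMap L K ((reduce p f k g).eval x) *
          (a * (y + algebraMap (ZMod p) K s)) ^ k = 0 := by
      intro s
      set y' := y + algebraMap (ZMod p) K s with hy'
      have hys : y' ^ p = y' + algebraMap L K (x + c / x) := by
        rw [hy', add_pow_char, hy, ← map_pow, ZMod.pow_card]; ring
      have hpow := pow_char_pow_of_artinSchreier hys
      have hw : (a * y') ^ p = a ^ (p - 1) * (a * y') + algebraMap L K (f.eval x) := by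
        have hx1 : x ^ p = x ^ (p - 1) * x := by rw [← pow_succ, Nat.sub_add_cancel hp0]
        have ha1 : a ^ p = a ^ (p - 1) * a := by rw [← pow_succ, Nat.sub_add_cancel hp0]
        have hfe : f.eval x = x ^ p * (x + c / x) := by
          simp only [f, eval_add, eval_mul, eval_pow, eval_X, eval_C, pow_succ, hx1]
          field_simp
        rw [mul_pow, hys, hfe, map_mul, map_pow, ← ha, ha1]
        ring
      have hzero : g.eval₂ ((algebraMap L K).comp (evalRingHom x)) (a * y') = 0 := by
        refine eval₂_auxPoly_eq_zero hL hv hw ?_ ?_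
        · have ha1 : a ^ p ^ (m + 1) = a ^ (p ^ (m + 1) - 1) * a := by
            rw [← pow_succ, Nat.sub_add_cancel (Nat.pow_pos hp0)]
          rw [mul_pow, hpow, eval_partialTrace hx0, map_mul, map_pow, ← ha, map_sum]
          simp only [map_pow]
          rw [mul_add, ha1]; ring
        · rw [← pow_mul, mul_pow, ← pow_add, hpow, htr, pow_add, ha, ← map_pow, hL, map_mul]
          ring
      rw [eval₂_eq_sum_reduce _ hp0 f (by simpa using hw) (natDegree_auxPoly_le hp0 _ _ _)] at hzero
      simpa using hzero
    set P : K[X] := ∑ k ∈ range p, C (algebraMap L K ((reduce p f k g).eval x)) * X ^ k with hP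
    have hPcoeff : ∀ k < p, P.coeff k = algebraMap L K ((reduce p f k g).eval x) := by
      intro k hk
      simp only [hP, finsetSum_coeff, coeff_C_mul_X_pow]
      rw [sum_ite_eq, if_pos (mem_range.2 hk)]
    have hPdeg : P.natDegree < p := by
      refine lt_of_le_of_lt (natDegree_sum_le_of_forall_le (n := p - 1) _ _ fun k hk =>
        (natDegree_C_mul_X_pow_le _ _).trans ?_) (by omega)
      have := mem_range.1 hk
      omega
    have hP0 : P = 0 := by
      refine eq_zero_of_natDegree_lt_card_of_eval_eq_zero P
        (f := fun s : ZMod p => a * (y + algebraMap (ZMod p) K s)) ?_ ?_ (by rwa [ZMod.card])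
      · intro s s' h
        exact (algebraMap (ZMod p) K).injective (add_left_cancel (mul_left_cancel₀ ha0 h))
      · intro s
        rw [hP, eval_finsetSum, ← hpoint s]
        exact sum_congr rfl fun k _ => by simp
    have := hPcoeff k hk
    rw [hP0, coeff_zero] at this
    exact (algebraMap L K).injective (by rw [← this, map_zero])
  refine (card_le_card hroot).trans ((Multiset.toFinset_card_le _).trans ((card_roots' _).trans
    (hdeg.trans ?_)))
  have h1 : I * p * p ^ m = (p ^ m + p + 1) * p ^ (m + 1) := by rw [hR]; ring
  have h2 : (p - 1) * p ^ (m + 1) + p ^ (m + 1) = p * p ^ (m + 1) := by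
    rw [← Nat.succ_mul]; congr 1; omega
  have h3 : p ^ m ≤ p ^ (m + 1) := Nat.pow_le_pow_right hp0 (by omega)
  have h4 : (p ^ m + p + 1) * p ^ (m + 1) =
    p ^ m * p ^ (m + 1) + p * p ^ (m + 1) + p ^ (m + 1) := by ring
  have h5 : (2 * p + 1) * p ^ (m + 1) = p * p ^ (m + 1) + p * p ^ (m + 1) + p ^ (m + 1) := by ring
  rw [h1]
  omega

end Stepanov

/-- The Kloosterman sum `∑_{x ≠ 0} ψ(x + c / x)`. -/
noncomputable def kloosterman {M : Type*} [Field M] [Fintype M] (ψ : AddChar M ℂ) (c : M) : ℂ :=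
  open scoped Classical in ∑ x : M, if x = 0 then 0 else ψ (x + c / x)

/-- The additive character of a finite field of characteristic `p` obtained from the trace. -/
noncomputable def traceChar (p : ℕ) [NeZero p] (M : Type*) [Field M] [Algebra (ZMod p) M] :
    AddChar M ℂ :=
  (ZMod.stdAddChar (N := p)).compAddMonoidHom (Algebra.trace (ZMod p) M).toAddMonoidHom

lemma traceChar_apply (p : ℕ) [NeZero p] (M : Type*) [Field M] [Algebra (ZMod p) M] (x : M) :
    traceChar p M x = ZMod.stdAddChar (Algebra.trace (ZMod p) M x) := rfl

lemma sum_mul_char_eq_ite {M : Type*} [Field M] [Fintype M] [DecidableEq M] {ψ : AddChar M ℂ}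
    (hψ : ψ ≠ 1) (a : M) :
    ∑ x : M, ψ (x * a) = if a = 0 then (Fintype.card M : ℂ) else 0 := by
  rw [AddChar.sum_mulShift a (AddChar.IsPrimitive.of_ne_one hψ)]
  split_ifs <;> simp

lemma traceChar_ne_one (p : ℕ) [Fact p.Prime] (M : Type*) [Field M] [Finite M]
    [Algebra (ZMod p) M] : traceChar p M ≠ 1 := by
  obtain ⟨x, hx⟩ := Algebra.trace_surjective (ZMod p) M 1
  intro h
  have h1 := DFunLike.congr_fun h x
  rw [traceChar_apply, hx, AddChar.one_apply] at h1
  have h2 := ZMod.injective_stdAddChar (N := p) (h1.trans (AddChar.map_zero_eq_one _).symm)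
  exact one_ne_zero h2

/-- The bound for Kloosterman sums over large fields coming from Stepanov's method. -/
lemma norm_kloosterman_le_of_stepanov {L : Type*} [Field L] [Fintype L] {p m : ℕ} [Fact p.Prime]
    [Algebra (ZMod p) L] (hcard : Fintype.card L = p ^ (m + 1) * p ^ (m + 1))
    (hm : 2 * (p + 1) ^ 2 ≤ p ^ m) (c : L) :
    ‖kloosterman (traceChar p L) c‖ ≤ (p * (2 * p + 1) + 1) * (p : ℝ) ^ (m + 1) := by
  classical
  set N : ZMod p → ℕ := fun t => #{x : L | x ≠ 0 ∧ Algebra.trace (ZMod p) L (x + c / x) = t}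
  set B : ℕ := p ^ m * p ^ (m + 1) + (2 * p + 1) * p ^ (m + 1) with hB
  have hN : ∀ t, N t ≤ B := fun t => Stepanov.card_filter_trace_le hcard hm c t
  have hp1 : 1 < p := (Fact.out : p.Prime).one_lt
  have hsum0 : ∑ t : ZMod p, (ZMod.stdAddChar t : ℂ) = 0 := by
    have h := AddChar.sum_mulShift (1 : ZMod p) (ZMod.isPrimitive_stdAddChar p)
    simpa using h
  have hfib : ∀ G : ZMod p → ℂ, (∑ x : L, if x = 0 then 0 else
      G (Algebra.trace (ZMod p) L (x + c / x))) = ∑ t, (N t : ℂ) * G t := by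
    intro G
    rw [← sum_fiberwise univ (fun x : L => Algebra.trace (ZMod p) L (x + c / x))]
    refine sum_congr rfl fun t _ => ?_
    simp only [N]
    rw [← nsmul_eq_mul, ← sum_const, sum_ite, sum_const_zero, zero_add, filter_filter]
    refine sum_congr ?_ ?_
    · ext x; simp [and_comm]
    · intro x hx
      rw [(mem_filter.1 hx).2.2]
  have hK : kloosterman (traceChar p L) c =
      ∑ t : ZMod p, ((N t : ℂ) - B) * ZMod.stdAddChar t := by
    simp only [sub_mul, sum_sub_distrib, ← mul_sum, hsum0, mul_zero, sub_zero]
    rw [← hfib]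
    rfl
  have htot : ∑ t, (N t : ℝ) = p ^ (m + 1) * p ^ (m + 1) - 1 := by
    have h1 := hfib fun _ => 1
    simp only [mul_one] at h1
    have h2 : (∑ x : L, if x = 0 then (0 : ℂ) else 1) = Fintype.card L - 1 := by
      rw [sum_ite, sum_const_zero, zero_add, sum_const, filter_ne', card_erase_of_mem (mem_univ _),
        card_univ, nsmul_eq_mul, mul_one, Nat.cast_sub Fintype.card_pos, Nat.cast_one]
    rw [h2, hcard] at h1
    exact_mod_cast h1.symm
  rw [hK]
  calc ‖∑ t : ZMod p, ((N t : ℂ) - B) * ZMod.stdAddChar t‖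
      ≤ ∑ t : ZMod p, ((B : ℝ) - N t) := by
        refine (norm_sum_le _ _).trans (sum_le_sum fun t _ => ?_)
        rw [norm_mul, AddChar.norm_apply, mul_one, norm_sub_rev,
          show ((B : ℂ) - N t) = ((B - N t : ℕ) : ℂ) by rw [Nat.cast_sub (hN t)],
          Complex.norm_natCast, Nat.cast_sub (hN t)]
    _ = p * B - (p ^ (m + 1) * p ^ (m + 1) - 1) := by
        rw [sum_sub_distrib, htot, sum_const, card_univ, ZMod.card, nsmul_eq_mul]
    _ = p * (2 * p + 1) * (p : ℝ) ^ (m + 1) + 1 := by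
        rw [hB]; push_cast; ring
    _ ≤ _ := by
        have : (1 : ℝ) ≤ (p : ℝ) ^ (m + 1) := one_le_pow₀ (by exact_mod_cast hp1.le)
        linarith

lemma sum_comp_eq_sum_card_mul {X Y : Type*} [Fintype X] [Fintype Y] [DecidableEq Y]
    (G : Y → ℂ) (g : X → Y) : ∑ x, G (g x) = ∑ y, (#{x | g x = y} : ℂ) * G y := by
  rw [← sum_fiberwise univ g]
  refine sum_congr rfl fun y _ => ?_
  rw [← nsmul_eq_mul, ← sum_const]
  exact sum_congr rfl fun x hx => by rw [(mem_filter.1 hx).2]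

section Quadratic

variable {M L : Type*} [Field M] [Field L] [Fintype M] [Fintype L] [Algebra M L]

lemma algebraMap_trace_of_finrank_two (h2 : Module.finrank M L = 2) (x : L) :
    algebraMap M L (Algebra.trace M L x) = x + x ^ Fintype.card M := by
  rw [FiniteField.algebraMap_trace_eq_sum_pow, h2, Nat.card_eq_fintype_card]
  simp [sum_range_succ]

lemma algebraMap_norm_of_finrank_two (h2 : Module.finrank M L = 2) (x : L) :
    algebraMap M L (Algebra.norm M x) = x * x ^ Fintype.card M := by
  rw [FiniteField.algebraMap_norm_eq_prod_pow, h2, Nat.card_eq_fintype_card]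
  simp [prod_range_succ]

/-- Elements of a quadratic extension with given trace and norm, together with factorisations of
the associated quadratic polynomial over the base field, number exactly two. -/
lemma card_trace_norm_add_card_pairs [DecidableEq M] (h2 : Module.finrank M L = 2) (y : M × M) :
    #{x : L | (Algebra.trace M L x, Algebra.norm M x) = y} +
      #{z : M × M | (z.1 + z.2, z.1 * z.2) = y} = 2 := by
  classical
  set ι := algebraMap M L
  have hι : Function.Injective ι := ι.injective
  have hle : ∀ y : M × M, #{x : L | (Algebra.trace M L x, Algebra.norm M x) = y} +
      #{z : M × M | (z.1 + z.2, z.1 * z.2) = y} ≤ 2 := by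
    rintro ⟨T, N⟩
    have hquad : ∀ x ∈ ({x : L | (Algebra.trace M L x, Algebra.norm M x) = (T, N)} : Finset L),
        x + x ^ Fintype.card M = ι T ∧ x * x ^ Fintype.card M = ι N := by
      intro x hx
      obtain ⟨h, h'⟩ := Prod.mk.inj (mem_filter.1 hx).2
      rw [← algebraMap_trace_of_finrank_two h2, ← algebraMap_norm_of_finrank_two h2, h, h']
      exact ⟨rfl, rfl⟩
    by_cases hz : ∃ a b : M, a + b = T ∧ a * b = N
    · obtain ⟨a, b, rfl, rfl⟩ := hz
      have hpairs : ({z : M × M | (z.1 + z.2, z.1 * z.2) = (a + b, a * b)} : Finset (M × M)) ⊆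
          {(a, b), (b, a)} := by
        rintro ⟨c, d⟩ hcd
        obtain ⟨h, h'⟩ := Prod.mk.inj (mem_filter.1 hcd).2
        have h0 : (c - a) * (c - b) = 0 := by linear_combination c * h - h'
        rcases mul_eq_zero.1 h0 with h1 | h1
        · have hc : c = a := sub_eq_zero.1 h1
          have hd : d = b := by linear_combination h - hc
          simp [hc, hd]
        · have hc : c = b := sub_eq_zero.1 h1
          have hd : d = a := by linear_combination h - hc
          simp [hc, hd]
      have hroots : ∀ x ∈ ({x : L | (Algebra.trace M L x, Algebra.norm M x) =
          (a + b, a * b)} : Finset L), x = ι a ∧ a = b := by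
        intro x hx
        obtain ⟨h, h'⟩ := hquad x hx
        rw [map_add] at h
        rw [map_mul] at h'
        have h0 : (x - ι a) * (x - ι b) = 0 := by linear_combination x * h - h'
        have hfix : ∀ e : M, (ι e) ^ Fintype.card M = ι e := fun e => by
          rw [← map_pow, FiniteField.pow_card]
        rcases mul_eq_zero.1 h0 with h1 | h1
        · have hxa : x = ι a := sub_eq_zero.1 h1
          rw [hxa, hfix] at h
          exact ⟨hxa, hι (by linear_combination h)⟩
        · have hxb : x = ι b := sub_eq_zero.1 h1
          rw [hxb, hfix] at h
          have hab : a = b := hι (by linear_combination -h)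
          exact ⟨by rw [hxb, hab], hab⟩
      by_cases hab : a = b
      · have h1 : #{x : L | (Algebra.trace M L x, Algebra.norm M x) = (a + b, a * b)} ≤ 1 :=
          card_le_one.2 fun x hx x' hx' => (hroots x hx).1.trans (hroots x' hx').1.symm
        have h3 := card_le_card hpairs
        rw [hab] at h3 h1 ⊢
        simp only [pair_eq_singleton, card_singleton] at h3
        omega
      · have h1 : ({x : L | (Algebra.trace M L x, Algebra.norm M x) = (a + b, a * b)} : Finset L) =
            ∅ := eq_empty_of_forall_notMem fun x hx => hab (hroots x hx).2
        rw [h1, card_empty, zero_add]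
        exact (card_le_card hpairs).trans card_le_two
    · have h1 : ({z : M × M | (z.1 + z.2, z.1 * z.2) = (T, N)} : Finset (M × M)) = ∅ := by
        refine eq_empty_of_forall_notMem fun z hz' => hz ⟨z.1, z.2, ?_⟩
        exact Prod.mk.inj (mem_filter.1 hz').2
      rw [h1, card_empty, add_zero]
      rcases eq_empty_or_nonempty
        ({x : L | (Algebra.trace M L x, Algebra.norm M x) = (T, N)} : Finset L) with he | ⟨x₀, hx₀⟩
      · rw [he]; simp
      · obtain ⟨h, h'⟩ := hquad x₀ hx₀
        refine (card_le_card (t := {x₀, x₀ ^ Fintype.card M}) fun x hx => ?_).trans card_le_two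
        obtain ⟨k, k'⟩ := hquad x hx
        have h0 : (x - x₀) * (x - x₀ ^ Fintype.card M) = 0 := by
          linear_combination x * (k - h) - (k' - h')
        rcases mul_eq_zero.1 h0 with h1 | h1
        · simp [sub_eq_zero.1 h1]
        · rw [sub_eq_zero] at h1; simp [← h1]
  have htot : ∑ y : M × M, (#{x : L | (Algebra.trace M L x, Algebra.norm M x) = y} +
      #{z : M × M | (z.1 + z.2, z.1 * z.2) = y}) = ∑ _y : M × M, 2 := by
    rw [sum_add_distrib, ← card_eq_sum_card_fiberwise (fun _ _ => mem_univ _),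
      ← card_eq_sum_card_fiberwise (fun _ _ => mem_univ _), card_univ, card_univ,
      Module.card_eq_pow_finrank (K := M) (V := L), h2, sum_const, card_univ, Fintype.card_prod,
      smul_eq_mul]
    ring
  exact (sum_eq_sum_iff_of_le fun y _ => hle y).1 htot y (mem_univ _)

/-- The relation between the Kloosterman sums over a finite field and its quadratic extension. -/
lemma kloosterman_quadratic (h2 : Module.finrank M L = 2) {ψ : AddChar M ℂ} (hψ : ψ ≠ 1)
    {ψ' : AddChar L ℂ} (hψ' : ∀ x, ψ' x = ψ (Algebra.trace M L x)) {c : M} (hc : c ≠ 0) :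
    kloosterman ψ' (algebraMap M L c) = 2 * Fintype.card M - kloosterman ψ c ^ 2 := by
  classical
  let G : M × M → ℂ := fun y => if y.2 = 0 then 0 else ψ (y.1 * (1 + c / y.2))
  have hL : kloosterman ψ' (algebraMap M L c) =
      ∑ x : L, G (Algebra.trace M L x, Algebra.norm M x) := by
    rw [kloosterman]
    refine sum_congr rfl fun x _ => ?_
    simp only [G, Algebra.norm_eq_zero_iff]
    split_ifs with hx
    · rfl
    rw [hψ']
    congr 1
    apply (algebraMap M L).injective
    have hn : algebraMap M L (Algebra.norm M x) ≠ 0 := by simpa using hx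
    have hx' : x ^ Fintype.card M ≠ 0 := pow_ne_zero _ hx
    rw [map_mul (algebraMap M L), map_add (algebraMap M L), map_div₀ (algebraMap M L),
      algebraMap_trace_of_finrank_two h2, algebraMap_trace_of_finrank_two h2,
      algebraMap_norm_of_finrank_two h2, map_one]
    have hadd : (x + algebraMap M L c / x) ^ Fintype.card M = x ^ Fintype.card M +
        algebraMap M L c / x ^ Fintype.card M := by
      have := map_add (FiniteField.frobeniusAlgHom M L) x (algebraMap M L c / x)
      simp only [FiniteField.coe_frobeniusAlgHom] at this
      rw [this, div_pow, ← map_pow, FiniteField.pow_card]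
    rw [hadd]
    field_simp
    ring
  have hM : kloosterman ψ c ^ 2 = ∑ z : M × M, G (z.1 + z.2, z.1 * z.2) := by
    rw [sq, kloosterman, sum_mul_sum, Fintype.sum_prod_type]
    refine sum_congr rfl fun a _ => sum_congr rfl fun b _ => ?_
    by_cases ha : a = 0
    · simp [G, ha]
    by_cases hb : b = 0
    · simp [G, hb]
    simp only [G, ha, hb, mul_eq_zero, or_self, if_false]
    rw [← AddChar.map_add_eq_mul]
    congr 1
    field_simp
    ring
  have hsum : ∑ y : M × M, G y = Fintype.card M := by
    rw [Fintype.sum_prod_type_right, sum_eq_single (-c)]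
    · simp [G, hc]
    · intro N _ hN
      by_cases hN0 : N = 0
      · simp [G, hN0]
      · simp only [G, hN0, if_false]
        rw [sum_mul_char_eq_ite hψ, if_neg]
        intro h
        field_simp at h
        exact hN (by linear_combination h)
    · simp
  rw [eq_sub_iff_add_eq, hL, hM, sum_comp_eq_sum_card_mul G, sum_comp_eq_sum_card_mul G, ← sum_add_distrib, ← hsum, mul_sum]
  refine sum_congr rfl fun y _ => ?_
  rw [← add_mul]
  congr 1
  exact_mod_cast card_trace_norm_add_card_pairs h2 y

end Quadratic

/-- If a Kloosterman sum exceeds the Weil bound, the excess is amplified along quadratic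
extensions. -/
lemma exists_extension_kloosterman_large (p : ℕ) [Fact p.Prime] (j : ℕ) :
    ∀ (M : Type) [Field M] [Fintype M] [Algebra (ZMod p) M] (c : M) (η : ℝ), c ≠ 0 → 0 ≤ η →
      (2 + η) * √(Fintype.card M) ≤ ‖kloosterman (traceChar p M) c‖ →
      ∃ (L : Type) (_ : Field L) (_ : Fintype L) (_ : Algebra (ZMod p) L) (c' : L),
        Fintype.card L = Fintype.card M ^ 2 ^ j ∧
        (2 + 4 ^ j * η) * √(Fintype.card L) ≤ ‖kloosterman (traceChar p L) c'‖ := by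
  induction j with
  | zero =>
    intro M _ _ _ c η _ _ h
    exact ⟨M, inferInstance, inferInstance, inferInstance, c, by simp, by simpa using h⟩
  | succ j ih =>
    intro M _ _ _ c η hc hη h
    have : CharP M p := charP_of_injective_algebraMap (algebraMap (ZMod p) M).injective p
    let L := FiniteField.Extension M p 2
    let : Fintype L := Fintype.ofFinite L
    have hcard : Fintype.card L = Fintype.card M ^ 2 := by
      rw [← Nat.card_eq_fintype_card, ← Nat.card_eq_fintype_card]
      exact FiniteField.natCard_extension M p 2
    have hψ' : ∀ x : L, traceChar p L x = traceChar p M (Algebra.trace M L x) := fun x => by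
      rw [traceChar_apply, traceChar_apply, Algebra.trace_trace]
    have hq := kloosterman_quadratic (FiniteField.finrank_extension M p 2) (traceChar_ne_one p M)
      hψ' hc
    have hsqrt : √(Fintype.card L : ℝ) = Fintype.card M := by
      rw [hcard, Nat.cast_pow, Real.sqrt_sq (Nat.cast_nonneg _)]
    have hL : (2 + 4 * η) * √(Fintype.card L) ≤
        ‖kloosterman (traceChar p L) (algebraMap M L c)‖ := by
      rw [hq, hsqrt, norm_sub_rev]
      have h1 := norm_sub_norm_le (kloosterman (traceChar p M) c ^ 2) (2 * (Fintype.card M : ℂ))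
      rw [norm_pow, norm_mul, Complex.norm_natCast, Complex.norm_ofNat] at h1
      have h3 := pow_le_pow_left₀ (by positivity) h 2
      rw [mul_pow, Real.sq_sqrt (Nat.cast_nonneg _)] at h3
      have h4 : 0 ≤ η ^ 2 * (Fintype.card M : ℝ) := by positivity
      linarith
    obtain ⟨L', i1, i2, i3, c', h1, h2⟩ := ih L (algebraMap M L c) (4 * η)
      ((map_ne_zero _).2 hc) (by positivity) hL
    refine ⟨L', i1, i2, i3, c', ?_, ?_⟩
    · rw [h1, hcard, ← pow_mul, pow_succ, mul_comm 2]
    · rwa [pow_succ, mul_assoc]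

/-- Weil's bound for Kloosterman sums. -/
lemma norm_kloosterman_le (p : ℕ) [Fact p.Prime] (M : Type) [Field M] [Fintype M]
    [Algebra (ZMod p) M] {c : M} (hc : c ≠ 0) :
    ‖kloosterman (traceChar p M) c‖ ≤ 2 * √(Fintype.card M) := by
  by_contra! hlt
  have hM : 0 < √(Fintype.card M : ℝ) := Real.sqrt_pos.2 (by exact_mod_cast Fintype.card_pos)
  set η := ‖kloosterman (traceChar p M) c‖ / √(Fintype.card M) - 2 with hηdef
  have hη : 0 < η := by rw [hηdef, sub_pos, lt_div_iff₀ hM]; exact hlt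
  obtain ⟨j, hj⟩ := pow_unbounded_of_one_lt ((p * (2 * p + 1) + 1) / η) (by norm_num : (1:ℝ) < 4)
  rw [div_lt_iff₀ hη] at hj
  obtain ⟨L, _, _, _, c', hcard, hL⟩ := exists_extension_kloosterman_large p (j + 4) M c η hc hη.le
    (by rw [hηdef, add_sub_cancel, div_mul_cancel₀ _ hM.ne'])
  have : CharP M p := charP_of_injective_algebraMap (algebraMap (ZMod p) M).injective p
  obtain ⟨r, -, hr⟩ := FiniteField.card M p
  have hp2 : 2 ≤ p := (Fact.out : p.Prime).two_le
  obtain ⟨m, hm⟩ : ∃ m : ℕ, (r : ℕ) * 2 ^ (j + 3) = m + 1 :=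
    Nat.exists_eq_succ_of_ne_zero (mul_ne_zero r.pos.ne' (by positivity))
  have hm5 : 5 ≤ m := by
    have h1 : 1 ≤ (r : ℕ) * 2 ^ j := Nat.mul_pos r.pos (by positivity)
    rw [pow_add, ← mul_assoc] at hm
    omega
  have hcard' : Fintype.card L = p ^ (m + 1) * p ^ (m + 1) := by
    rw [hcard, hr, ← hm, ← pow_add, ← pow_mul]
    congr 1
    ring
  have hpm : 2 * (p + 1) ^ 2 ≤ p ^ m := by
    refine le_trans ?_ (Nat.pow_le_pow_right (by omega) hm5)
    have h1 : p + 1 ≤ p ^ 2 := by nlinarith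
    calc 2 * (p + 1) ^ 2 ≤ p * (p ^ 2) ^ 2 := by gcongr
      _ = p ^ 5 := by ring
  have hS := norm_kloosterman_le_of_stepanov hcard' hpm c'
  have hpos : (0 : ℝ) < (p : ℝ) ^ (m + 1) := by positivity
  have hsqrt : √(Fintype.card L : ℝ) = (p : ℝ) ^ (m + 1) := by
    rw [hcard']; push_cast; exact Real.sqrt_mul_self hpos.le
  rw [hsqrt] at hL
  have h5 := le_of_mul_le_mul_right (hL.trans hS) hpos
  have h6 : (4 : ℝ) ^ j * η ≤ 4 ^ (j + 4) * η := by
    gcongr <;> norm_num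
  linarith

lemma sum_units_eq_sub {F : Type*} [Field F] [Fintype F] [DecidableEq F] (f : F → ℂ) :
    ∑ s : Fˣ, f s = ∑ s, f s - f 0 := by
  rw [eq_sub_iff_add_eq', ← add_sum_erase univ f (mem_univ 0)]
  congr 1
  refine sum_bij (fun s _ => (s : F)) (by simp) (fun a _ b _ h => Units.ext h) ?_ (by simp)
  intro b hb
  exact ⟨Units.mk0 b (ne_of_mem_erase hb), mem_univ _, rfl⟩

lemma kloosterman_eq_sum_units {F : Type*} [Field F] [Fintype F] [DecidableEq F]
    (ψ : AddChar F ℂ) (c : F) :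
    kloosterman ψ c = ∑ s : Fˣ, ψ (s + c / s) := by
  have h := sum_units_eq_sub (fun x : F => if x = 0 then (0 : ℂ) else ψ (x + c / x))
  simp only [Units.ne_zero, if_false, if_true, sub_zero] at h
  rw [h, kloosterman]
  exact sum_congr rfl fun x _ => by congr

section GaussSum

variable {F V : Type*} [Field F] [AddCommGroup V] [Module F V] [Fintype V]

/-- The Gauss sum of a quadratic form. -/
noncomputable def quadGauss (ψ : AddChar F ℂ) (Q : QuadraticForm F V) (s : F) : ℂ :=
  ∑ z : V, ψ (s * Q z)

lemma quadGauss_mul_sq (ψ : AddChar F ℂ) (Q : QuadraticForm F V) (s : F) {r : F} (hr : r ≠ 0) :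
    quadGauss ψ Q (s * r ^ 2) = quadGauss ψ Q s := by
  refine Fintype.sum_equiv (LinearEquiv.smulOfNeZero F V r hr).toEquiv _ _ fun z => ?_
  simp [QuadraticMap.map_smul]
  ring_nf

/-- Completing the square in a Gauss sum. -/
lemma sum_char_add_polar (ψ : AddChar F ℂ) (Q : QuadraticForm F V) {s : F} (hs : s ≠ 0) (m : V) :
    ∑ z : V, ψ (s * Q z + QuadraticMap.polar Q z m) = ψ (-(Q m / s)) * quadGauss ψ Q s := by
  rw [quadGauss, mul_sum]
  refine Fintype.sum_equiv (Equiv.addRight (s⁻¹ • m)) _ _ fun z => ?_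
  rw [← AddChar.map_add_eq_mul, Equiv.coe_addRight, QuadraticMap.map_add Q, QuadraticMap.map_smul,
    QuadraticMap.polar_smul_right]
  congr 1
  simp only [smul_eq_mul]
  field_simp
  ring

/-- Orthogonality of the characters attached to a non-degenerate form. -/
lemma sum_char_polar [DecidableEq V] {ψ : AddChar F ℂ} (hψ : ψ ≠ 1) {Q : QuadraticForm F V}
    (hQ : Q.polarBilin.Nondegenerate) (h : V) :
    ∑ w : V, ψ (QuadraticMap.polar Q w h) = if h = 0 then (Fintype.card V : ℂ) else 0 := by
  split_ifs with h0
  · simp [h0]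
  let χ : AddChar V ℂ := ψ.compAddMonoidHom (Q.polarBilin.flip h).toAddMonoidHom
  refine AddChar.sum_eq_zero_iff_ne_zero (ψ := χ) |>.2 fun hχ => hψ ?_
  obtain ⟨w, hw⟩ : ∃ w, Q.polarBilin w h ≠ 0 := by
    by_contra! H
    exact h0 (hQ.2 h H)
  ext a
  have := DFunLike.congr_fun hχ ((a / Q.polarBilin w h) • w)
  have h1 : χ ((a / Q.polarBilin w h) • w) = ψ a := by
    change ψ (Q.polarBilin ((a / Q.polarBilin w h) • w) h) = _
    rw [map_smul, LinearMap.smul_apply, smul_eq_mul, div_mul_cancel₀ _ hw]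
  rw [← h1, this]
  rfl

lemma norm_quadGauss_sq [Finite F] {ψ : AddChar F ℂ} (hψ : ψ ≠ 1) {Q : QuadraticForm F V}
    (hQ : Q.polarBilin.Nondegenerate) {s : F} (hs : s ≠ 0) :
    ‖quadGauss ψ Q s‖ ^ 2 = Fintype.card V := by
  classical
  have key : quadGauss ψ Q s * (starRingEnd ℂ) (quadGauss ψ Q s) = Fintype.card V := by
    rw [quadGauss, map_sum, sum_mul_sum, sum_comm]
    calc ∑ w : V, ∑ z : V, ψ (s * Q z) * (starRingEnd ℂ) (ψ (s * Q w))
        = ∑ w : V, ∑ h : V, ψ (s * Q h) * ψ (QuadraticMap.polar Q w (s • h)) := by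
          refine sum_congr rfl fun w _ =>
            (Fintype.sum_equiv (Equiv.addLeft w) _ _ fun h => ?_).symm
          rw [← AddChar.map_neg_eq_conj, ← AddChar.map_add_eq_mul, ← AddChar.map_add_eq_mul,
            Equiv.coe_addLeft, QuadraticMap.map_add Q, QuadraticMap.polar_smul_right, smul_eq_mul]
          congr 1
          ring
      _ = ∑ h : V, ψ (s * Q h) * (if h = 0 then (Fintype.card V : ℂ) else 0) := by
          rw [sum_comm]
          refine sum_congr rfl fun h _ => ?_
          rw [← mul_sum, sum_char_polar hψ hQ]
          simp [hs]
      _ = Fintype.card V := by simp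
  rw [Complex.mul_conj, Complex.normSq_eq_norm_sq] at key
  exact_mod_cast key

lemma polarBilin_sq_nondegenerate (h2 : (2 : F) ≠ 0) :
    (QuadraticMap.polarBilin (QuadraticMap.sq : QuadraticForm F F)).Nondegenerate := by
  have h : ∀ x y : F, QuadraticMap.polarBilin (QuadraticMap.sq : QuadraticForm F F) x y =
      2 * x * y := fun x y => by
    simp [QuadraticMap.polar]
    ring
  constructor
  · intro x hx
    have := hx 1
    rw [h] at this
    simpa [h2] using this
  · intro y hy
    have := hy 1
    rw [h] at this
    simpa [h2] using this

/-- The Gauss sum `∑ ψ(s z²)` changes sign when `s` is multiplied by a non-square. -/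
lemma quadGauss_sq_mul_nonsquare [Fintype F] [DecidableEq F] (hF : ringChar F ≠ 2) {ψ : AddChar F ℂ}
    (hψ : ψ ≠ 1) {s a : F} (hs : s ≠ 0) (ha : ¬ IsSquare a) :
    quadGauss ψ (QuadraticMap.sq : QuadraticForm F F) (a * s) =
      -quadGauss ψ (QuadraticMap.sq : QuadraticForm F F) s := by
  have ha0 : a ≠ 0 := by rintro rfl; exact ha (IsSquare.zero)
  have hcard : ∀ x : F, ((#{z : F | z * z = x} : ℕ) : ℂ) = quadraticChar F x + 1 := fun x => by
    have := quadraticChar_card_sqrts hF x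
    simp only [Set.toFinset_ofPred, sq] at this
    exact_mod_cast this
  have hg : ∀ s : F, s ≠ 0 → quadGauss ψ (QuadraticMap.sq : QuadraticForm F F) s =
      ∑ x : F, (quadraticChar F x : ℂ) * ψ (x * s) := fun s hs => by
    have h0 := sum_mul_char_eq_ite hψ s
    rw [if_neg hs] at h0
    rw [quadGauss]
    simp only [QuadraticMap.sq_apply, mul_comm s]
    rw [sum_comp_eq_sum_card_mul (fun x : F => ψ (x * s)) (fun z : F => z * z)]
    simp only [hcard, add_mul, one_mul, sum_add_distrib, h0, add_zero]
  rw [hg _ hs, hg _ (mul_ne_zero ha0 hs), ← sum_neg_distrib]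
  refine Fintype.sum_equiv (Equiv.mulRight₀ a ha0) _ _ fun x => ?_
  simp only [Equiv.mulRight₀_apply]
  rw [map_mul (quadraticChar F), quadraticChar_neg_one_iff_not_isSquare.2 ha, mul_assoc x]
  push_cast
  ring

/-- The bound for Salié sums. -/
lemma norm_salie_le [Fintype F] [DecidableEq F] (hF : ringChar F ≠ 2) {ψ : AddChar F ℂ} (hψ : ψ ≠ 1)
    (u v : F) :
    ‖∑ s : Fˣ, quadGauss ψ (QuadraticMap.sq : QuadraticForm F F) s * ψ (u * s + v / s)‖ ≤
      2 * Fintype.card F := by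
  have h2 : (2 : F) ≠ 0 := Ring.two_ne_zero hF
  have hsq : ∀ u y : F, ‖∑ s : Fˣ, quadGauss ψ (QuadraticMap.sq : QuadraticForm F F) s *
      ψ (u * s + -(y * y) / s)‖ ≤ 2 * Fintype.card F := by
    intro u y
    have h1 : ∑ s : Fˣ, quadGauss ψ (QuadraticMap.sq : QuadraticForm F F) s *
        ψ (u * s + -(y * y) / s) =
        ∑ z : F, ψ (2 * y * z) * ((if z * z + u = 0 then (Fintype.card F : ℂ) else 0) - 1) := by
      calc _ = ∑ s : Fˣ, ∑ z : F, ψ (2 * y * z) * ψ (s * (z * z + u)) := by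
            refine sum_congr rfl fun s _ => ?_
            have := sum_char_add_polar ψ (QuadraticMap.sq : QuadraticForm F F) s.ne_zero y
            rw [QuadraticMap.sq_apply] at this
            rw [add_comm, AddChar.map_add_eq_mul, neg_div, ← mul_assoc,
              mul_comm (quadGauss _ _ _), ← this, sum_mul]
            refine sum_congr rfl fun z _ => ?_
            rw [← AddChar.map_add_eq_mul, ← AddChar.map_add_eq_mul]
            congr 1
            simp only [QuadraticMap.polar, QuadraticMap.sq_apply]
            ring
        _ = _ := by
            rw [sum_comm]
            refine sum_congr rfl fun z _ => ?_
            rw [← mul_sum, sum_units_eq_sub (fun s => ψ (s * (z * z + u))),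
              sum_mul_char_eq_ite hψ, zero_mul, AddChar.map_zero_eq_one]
    have hN : #{z : F | z * z + u = 0} ≤ 2 := by
      have h3 := quadraticChar_card_sqrts hF (-u)
      simp only [Set.toFinset_ofPred, sq, eq_neg_iff_add_eq_zero] at h3
      have h5 : quadraticChar F (-u) ≤ 1 := by
        by_cases hu : -u = 0
        · rw [hu, quadraticChar_zero]; norm_num
        · rcases quadraticChar_dichotomy hu with h | h <;> rw [h]; norm_num
      omega
    have hq : (1 : ℝ) ≤ Fintype.card F := by exact_mod_cast Fintype.card_pos
    rw [h1]
    simp only [mul_sub, mul_one, sum_sub_distrib, mul_ite, mul_zero]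
    rw [← sum_filter, ← sum_mul]
    by_cases hy : y = 0
    · simp only [hy, mul_zero, zero_mul, AddChar.map_zero_eq_one, sum_const, nsmul_eq_mul, mul_one,
        card_univ]
      interval_cases hn : #{z : F | z * z + u = 0}
      · simp; linarith
      · simp
      · rw [show ((2 : ℕ) : ℂ) * Fintype.card F - Fintype.card F = Fintype.card F by push_cast; ring,
          Complex.norm_natCast]
        linarith
    · have h0 : ∑ z : F, ψ (2 * y * z) = 0 := by
        have := sum_mul_char_eq_ite hψ (2 * y)
        rw [if_neg (mul_ne_zero h2 hy)] at this
        simpa only [mul_comm] using this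
      rw [h0, sub_zero, norm_mul, Complex.norm_natCast]
      gcongr
      refine (norm_sum_le _ _).trans ?_
      simp only [AddChar.norm_apply, sum_const, nsmul_eq_mul, mul_one]
      exact_mod_cast hN
  by_cases hv : IsSquare (-v)
  · obtain ⟨y, hy⟩ := hv
    rw [show v = -(y * y) by rw [← hy, neg_neg]]
    exact hsq u y
  · have hv0 : v ≠ 0 := by rintro rfl; exact hv (by simp)
    rw [← norm_neg, ← sum_neg_distrib]
    refine le_of_eq_of_le (congrArg norm ?_) (hsq (u * -v) 1)
    refine (Fintype.sum_equiv (Equiv.mulLeft (Units.mk0 (-v) (neg_ne_zero.2 hv0))) _ _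
      fun s => ?_).symm
    have hs := s.ne_zero
    rw [Equiv.coe_mulLeft, Units.val_mul, Units.val_mk0, quadGauss_sq_mul_nonsquare hF hψ hs hv,
      neg_mul, neg_neg]
    congr 2
    field_simp

/-- Twisted Kloosterman sums whose weight depends only on the square class. -/
lemma norm_sum_units_le [Fintype F] [DecidableEq F] (hF : ringChar F ≠ 2) {ψ : AddChar F ℂ} (hψ : ψ ≠ 1)
    (hW : ∀ c : F, c ≠ 0 → ‖kloosterman ψ c‖ ≤ 2 * √(Fintype.card F))
    {H : F → ℂ} (hH : ∀ s r : F, s ≠ 0 → r ≠ 0 → H (s * r ^ 2) = H s)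
    {C : ℝ} (hC : ∀ s, s ≠ 0 → ‖H s‖ ≤ C) {u : F} (hu : u ≠ 0) (v : F) :
    ‖∑ s : Fˣ, H s * ψ (u * s + v / s)‖ ≤ 4 * C * √(Fintype.card F) := by
  obtain ⟨n, hn⟩ := FiniteField.exists_nonsquare hF
  have hn0 : n ≠ 0 := by rintro rfl; exact hn IsSquare.zero
  set g := quadGauss ψ (QuadraticMap.sq : QuadraticForm F F) with hg
  have hq : (1 : ℝ) ≤ Fintype.card F := by exact_mod_cast Fintype.card_pos
  have hsq1 : 1 ≤ √(Fintype.card F : ℝ) := Real.one_le_sqrt.2 hq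
  have hgn : ‖g 1‖ = √(Fintype.card F) := by
    rw [← norm_quadGauss_sq hψ (polarBilin_sq_nondegenerate (Ring.two_ne_zero hF)) one_ne_zero,
      Real.sqrt_sq (norm_nonneg _)]
  have hg0 : g 1 ≠ 0 := norm_pos_iff.1 (by rw [hgn]; linarith)
  have hC0 : 0 ≤ C := (norm_nonneg _).trans (hC 1 one_ne_zero)
  set α := (H 1 + H n) / 2
  set β := (H 1 - H n) / (2 * g 1)
  have hα : ‖α‖ ≤ C := by
    rw [norm_div, Complex.norm_ofNat, div_le_iff₀ two_pos]
    linarith [norm_add_le (H 1) (H n), hC 1 one_ne_zero, hC n hn0]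
  have hβ : ‖β‖ ≤ C / √(Fintype.card F) := by
    rw [norm_div, norm_mul, Complex.norm_ofNat, hgn, ← div_div]
    gcongr
    linarith [norm_sub_le (H 1) (H n), hC 1 one_ne_zero, hC n hn0]
  have hdec : ∀ s : Fˣ, H s = α + β * g s := by
    intro s
    have hs := s.ne_zero
    by_cases h : IsSquare (s : F)
    · obtain ⟨r, hr⟩ := h
      have hr0 : r ≠ 0 := by rintro rfl; simp at hr
      rw [hr, ← sq, ← one_mul (r ^ 2), hH 1 r one_ne_zero hr0, hg, quadGauss_mul_sq _ _ _ hr0, ← hg]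
      simp only [α, β]
      field_simp
      ring
    · have hsn : IsSquare ((s : F) / n) := by
        rw [← quadraticChar_one_iff_isSquare (div_ne_zero hs hn0)]
        have h1 := quadraticChar_neg_one_iff_not_isSquare.2 h
        rw [← div_mul_cancel₀ (s : F) hn0, map_mul, quadraticChar_neg_one_iff_not_isSquare.2 hn] at h1
        linarith
      obtain ⟨r, hr⟩ := hsn
      have hr0 : r ≠ 0 := by rintro rfl; simp [hn0] at hr
      have hs' : (s : F) = n * r ^ 2 := by field_simp at hr; rw [hr]
      rw [hs', hH n r hn0 hr0, hg, quadGauss_mul_sq _ _ _ hr0, ← mul_one n,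
        quadGauss_sq_mul_nonsquare hF hψ one_ne_zero hn, ← hg, mul_one]
      simp only [α, β]
      field_simp
      ring
  have hK : ‖∑ s : Fˣ, ψ (u * s + v / s)‖ ≤ 2 * √(Fintype.card F) := by
    by_cases hv : v = 0
    · have h0 := sum_mul_char_eq_ite hψ u
      rw [if_neg hu] at h0
      simp only [hv, zero_div, add_zero]
      simp only [mul_comm u]
      rw [sum_units_eq_sub (fun s => ψ (s * u)), h0]
      simp
      linarith
    · refine le_of_eq_of_le (congrArg norm ?_) (hW (u * v) (mul_ne_zero hu hv))
      rw [kloosterman_eq_sum_units]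
      refine Fintype.sum_equiv (Equiv.mulLeft (Units.mk0 u hu)) _ _ fun s => ?_
      rw [Equiv.coe_mulLeft, Units.val_mul, Units.val_mk0, mul_div_mul_left _ _ hu]
  calc ‖∑ s : Fˣ, H s * ψ (u * s + v / s)‖
      = ‖α * ∑ s : Fˣ, ψ (u * s + v / s) + β * ∑ s : Fˣ, g s * ψ (u * s + v / s)‖ := by
        rw [mul_sum, mul_sum, ← sum_add_distrib]
        congr 1
        refine sum_congr rfl fun s _ => ?_
        rw [hdec]
        ring
    _ ≤ C * (2 * √(Fintype.card F)) + C / √(Fintype.card F) * (2 * Fintype.card F) := by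
        refine (norm_add_le _ _).trans ?_
        rw [norm_mul, norm_mul]
        gcongr
        exact norm_salie_le hF hψ u v
    _ = _ := by
        have : (Fintype.card F : ℝ) = √(Fintype.card F) * √(Fintype.card F) :=
          (Real.mul_self_sqrt (by positivity)).symm
        nth_rewrite 3 [this]
        field_simp
        ring

end GaussSum

/-- The Fourier transform of the indicator function of `E` with respect to the polar form. -/
noncomputable def polarFourier {F V : Type*} [Field F] [AddCommGroup V] [Module F V]
    (ψ : AddChar F ℂ) (Q : QuadraticForm F V) (E : Finset V) (m : V) : ℂ :=
  ∑ x ∈ E, ψ (QuadraticMap.polar Q m x)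

section Fourier

variable {F V : Type*} [Field F] [AddCommGroup V] [Module F V]

lemma char_polar_sum (ψ : AddChar F ℂ) (Q : QuadraticForm F V) (m : V) {ι : Type*} (s : Finset ι)
    (x : ι → V) :
    ψ (QuadraticMap.polar Q m (∑ i ∈ s, x i)) = ∏ i ∈ s, ψ (QuadraticMap.polar Q m (x i)) := by
  classical
  induction s using Finset.induction_on with
  | empty => simp
  | insert a s ha ih =>
    rw [sum_insert ha, prod_insert ha, QuadraticMap.polar_add_right, AddChar.map_add_eq_mul, ih]

lemma sum_piFinset_char_polar (ψ : AddChar F ℂ) (Q : QuadraticForm F V) (E : Finset V) (m : V)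
    (k : ℕ) :
    ∑ x ∈ Fintype.piFinset (fun _ : Fin k => E), ψ (QuadraticMap.polar Q m (∑ i, x i)) =
      polarFourier ψ Q E m ^ k := by
  simp only [char_polar_sum]
  rw [← prod_univ_sum (fun _ : Fin k => E) (fun _ x => ψ (QuadraticMap.polar Q m x)), prod_const,
    card_univ, Fintype.card_fin]
  rfl

lemma conj_polarFourier [Finite F] (ψ : AddChar F ℂ) (Q : QuadraticForm F V) (E : Finset V)
    (m : V) :
    (starRingEnd ℂ) (polarFourier ψ Q E m) = ∑ x ∈ E, ψ (QuadraticMap.polar Q m (-x)) := by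
  rw [polarFourier, map_sum]
  simp only [QuadraticMap.polar_neg_right, AddChar.map_neg_eq_conj]

/-- The character expansion of the energy. -/
lemma sum_norm_polarFourier_pow [Finite F] {V : Type} [AddCommGroup V] [Module F V] [Fintype V]
    {ψ : AddChar F ℂ} (hψ : ψ ≠ 1) {Q : QuadraticForm F V}
    (hQ : Q.polarBilin.Nondegenerate) (E : Finset V) (j : ℕ) :
    ∑ m, ‖polarFourier ψ Q E m‖ ^ (2 * j) = Fintype.card V * energy E (2 * j) := by
  classical
  have hen : energy E (2 * j) = #{x ∈ Fintype.piFinset (fun _ : Fin (2 * j) => E) |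
      (∑ i with i.val < j, x i) - ∑ i with ¬ i.val < j, x i = 0} := by
    rw [energy, Nat.card_eq_fintype_card, Fintype.card_subtype, Nat.mul_div_cancel_left _ two_pos]
    congr 1
    ext x
    simp [sub_eq_zero]
  have hpt : ∀ m, ((‖polarFourier ψ Q E m‖ ^ (2 * j) : ℝ) : ℂ) =
      ∑ x ∈ Fintype.piFinset (fun _ : Fin (2 * j) => E),
        ψ (QuadraticMap.polar Q m ((∑ i with i.val < j, x i) - ∑ i with ¬ i.val < j, x i)) := by
    intro m
    have hx : ∀ x : Fin (2 * j) → V,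
        ψ (QuadraticMap.polar Q m ((∑ i with i.val < j, x i) - ∑ i with ¬ i.val < j, x i)) =
        ∏ i, if i.val < j then ψ (QuadraticMap.polar Q m (x i)) else
          ψ (QuadraticMap.polar Q m (-x i)) := by
      intro x
      rw [sub_eq_add_neg, ← sum_neg_distrib, QuadraticMap.polar_add_right,
        AddChar.map_add_eq_mul, char_polar_sum, char_polar_sum, prod_ite]
    simp only [hx]
    rw [← prod_univ_sum (fun _ : Fin (2 * j) => E) (fun i x => if i.val < j then
      ψ (QuadraticMap.polar Q m x) else ψ (QuadraticMap.polar Q m (-x)))]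
    have hcard : #{i : Fin (2 * j) | i.val < j} = j := by
      rw [Fin.card_filter_val_lt]; omega
    have hcard' : #{i : Fin (2 * j) | ¬ i.val < j} = j := by
      have := card_filter_add_card_filter_not (s := univ) (fun i : Fin (2 * j) => i.val < j)
      rw [hcard, card_univ, Fintype.card_fin] at this
      omega
    have hi : ∀ i : Fin (2 * j), (∑ x ∈ E, if i.val < j then ψ (QuadraticMap.polar Q m x) else
        ψ (QuadraticMap.polar Q m (-x))) = if i.val < j then polarFourier ψ Q E m else
        (starRingEnd ℂ) (polarFourier ψ Q E m) := by
      intro i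
      split_ifs
      · rfl
      · rw [conj_polarFourier]
    simp only [hi]
    rw [prod_ite, prod_const, prod_const, hcard, hcard', ← mul_pow, Complex.mul_conj,
      Complex.normSq_eq_norm_sq, pow_mul]
    push_cast
    rfl
  have key : ((∑ m, ‖polarFourier ψ Q E m‖ ^ (2 * j) : ℝ) : ℂ) =
      Fintype.card V * energy E (2 * j) := by
    rw [Complex.ofReal_sum]
    simp only [hpt]
    rw [sum_comm]
    simp only [sum_char_polar hψ hQ]
    rw [← sum_filter, sum_const, hen, nsmul_eq_mul, mul_comm]
  exact_mod_cast key

/-- Cauchy–Schwarz: odd moments of the Fourier transform are bounded by energies. -/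
lemma sum_norm_polarFourier_pow_odd_le [Finite F] {V : Type} [AddCommGroup V] [Module F V]
    [Fintype V] {ψ : AddChar F ℂ} (hψ : ψ ≠ 1) {Q : QuadraticForm F V}
    (hQ : Q.polarBilin.Nondegenerate) (E : Finset V) (j : ℕ) :
    ∑ m, ‖polarFourier ψ Q E m‖ ^ (2 * j + 1) ≤
      Fintype.card V * (√(energy E (2 * j)) * √(energy E (2 * (j + 1)))) := by
  have h := Real.sum_mul_le_sqrt_mul_sqrt univ (fun m => ‖polarFourier ψ Q E m‖ ^ j)
    (fun m => ‖polarFourier ψ Q E m‖ ^ (j + 1))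
  simp only [← pow_mul, ← pow_add, mul_comm j 2, mul_comm (j + 1) 2] at h
  rw [sum_norm_polarFourier_pow hψ hQ, sum_norm_polarFourier_pow hψ hQ,
    Real.sqrt_mul (Nat.cast_nonneg _), Real.sqrt_mul (Nat.cast_nonneg _), mul_mul_mul_comm,
    Real.mul_self_sqrt (Nat.cast_nonneg _)] at h
  rwa [show 2 * j + 1 = j + (j + 1) by ring]

/-- Fourier expansion of a character evaluated at a quadratic form. -/
lemma char_quadratic_eq_sum [Finite F] [Fintype V] {ψ : AddChar F ℂ} (hψ : ψ ≠ 1)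
    {Q : QuadraticForm F V} (hQ : Q.polarBilin.Nondegenerate) {s : F} (hs : s ≠ 0) (y : V) :
    ψ (s * Q y) = (quadGauss ψ Q (-s⁻¹))⁻¹ *
      ∑ m : V, ψ (-Q m / s) * ψ (QuadraticMap.polar Q m y) := by
  have hs' : -s⁻¹ ≠ 0 := neg_ne_zero.2 (inv_ne_zero hs)
  have hG : quadGauss ψ Q (-s⁻¹) ≠ 0 := by
    intro h
    have := norm_quadGauss_sq hψ hQ hs'
    rw [h, norm_zero, zero_pow two_ne_zero] at this
    exact Fintype.card_ne_zero (by exact_mod_cast this.symm : Fintype.card V = 0)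
  have h := sum_char_add_polar ψ Q hs' y
  rw [show -(Q y / -s⁻¹) = s * Q y by field_simp] at h
  rw [eq_inv_mul_iff_mul_eq₀ hG, mul_comm, ← h]
  refine sum_congr rfl fun m _ => ?_
  rw [← AddChar.map_add_eq_mul]
  congr 1
  field_simp

/-- The error term in the count of tuples with `Q(x¹ + ⋯ + x^k) = t`, bounded by energies. -/
lemma abs_card_mul_nuQ_sub_le {F : Type} [Field F] [Fintype F] {d : ℕ}
    (hF : ringChar F ≠ 2) {ψ : AddChar F ℂ} (hψ : ψ ≠ 1)
    (hW : ∀ c : F, c ≠ 0 → ‖kloosterman ψ c‖ ≤ 2 * √(Fintype.card F))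
    {Q : QuadraticForm F (Fin d → F)} (hQ : Q.polarBilin.Nondegenerate)
    (E : Finset (Fin d → F)) (j : ℕ) {t : F} (ht : t ≠ 0) :
    |(Fintype.card F : ℝ) * nuQ Q E (2 * j + 1) t - (#E : ℝ) ^ (2 * j + 1)| ≤
      4 * ((Fintype.card F : ℝ) ^ (((d : ℝ) + 1) / 2) *
        (√(energy E (2 * j)) * √(energy E (2 * (j + 1))))) := by
  classical
  set k := 2 * j + 1 with hk
  set q : ℝ := (Fintype.card F : ℝ) with hq
  have hq0 : 0 < q := by rw [hq]; exact_mod_cast Fintype.card_pos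
  have hcV : (Fintype.card (Fin d → F) : ℝ) = q ^ d := by simp [hq]
  set P := Fintype.piFinset (fun _ : Fin k => E)
  set H : F → ℂ := fun s => (quadGauss ψ Q (-s⁻¹))⁻¹ with hHdef
  have hnu : nuQ Q E k t = #{x ∈ P | Q (∑ i, x i) - t = 0} := by
    rw [nuQ, Nat.card_eq_fintype_card, Fintype.card_subtype]
    congr 1
    ext x
    simp [P, sub_eq_zero]
  have hHsq : ∀ s r : F, s ≠ 0 → r ≠ 0 → H (s * r ^ 2) = H s := by
    intro s r _ hr
    simp only [hHdef]
    rw [mul_inv, ← inv_pow, ← neg_mul, quadGauss_mul_sq _ _ _ (inv_ne_zero hr)]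
  have hHC : ∀ s : F, s ≠ 0 → ‖H s‖ ≤ (√(q ^ d))⁻¹ := by
    intro s hs
    have h := norm_quadGauss_sq hψ hQ (neg_ne_zero.2 (inv_ne_zero hs))
    rw [hcV] at h
    rw [hHdef, norm_inv, ← h, Real.sqrt_sq (norm_nonneg _)]
  have hexp : ((q * nuQ Q E k t - (#E : ℝ) ^ k : ℝ) : ℂ) =
      ∑ m, (∑ s : Fˣ, H s * ψ (-t * s + -Q m / s)) * polarFourier ψ Q E m ^ k := by
    have h1 : ((q * nuQ Q E k t : ℝ) : ℂ) = ∑ x ∈ P, ∑ s : F, ψ (s * (Q (∑ i, x i) - t)) := by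
      simp only [sum_mul_char_eq_ite hψ]
      rw [← sum_filter, sum_const, hnu, nsmul_eq_mul, hq]
      push_cast
      ring
    have h2 : (((#E : ℝ) ^ k : ℝ) : ℂ) = ∑ x ∈ P, 1 := by
      simp [P]
    rw [Complex.ofReal_sub, h1, h2, ← sum_sub_distrib]
    have h3 : ∀ x : Fin k → Fin d → F, ∑ s : F, ψ (s * (Q (∑ i, x i) - t)) - 1 =
        ∑ m, (∑ s : Fˣ, H s * ψ (-t * s + -Q m / s)) *
          ψ (QuadraticMap.polar Q m (∑ i, x i)) := by
      intro x
      have h4 := sum_units_eq_sub fun s : F => ψ (s * (Q (∑ i, x i) - t))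
      rw [zero_mul, AddChar.map_zero_eq_one] at h4
      rw [← h4]
      simp only [sum_mul]
      rw [sum_comm]
      refine sum_congr rfl fun s _ => ?_
      rw [show (s : F) * (Q (∑ i, x i) - t) = s * Q (∑ i, x i) + -t * s by ring,
        AddChar.map_add_eq_mul, char_quadratic_eq_sum hψ hQ s.ne_zero, mul_sum, sum_mul]
      refine sum_congr rfl fun m _ => ?_
      rw [AddChar.map_add_eq_mul]
      ring
    simp only [h3]
    rw [sum_comm]
    refine sum_congr rfl fun m _ => ?_
    rw [← mul_sum, sum_piFinset_char_polar]
  rw [← Real.norm_eq_abs, ← Complex.norm_real, hexp]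
  have hsd : 0 < √(q ^ d) := Real.sqrt_pos.2 (by positivity)
  calc ‖∑ m, (∑ s : Fˣ, H s * ψ (-t * s + -Q m / s)) * polarFourier ψ Q E m ^ k‖
      ≤ ∑ m, 4 * (√(q ^ d))⁻¹ * √q * ‖polarFourier ψ Q E m‖ ^ k := by
        refine (norm_sum_le _ _).trans (sum_le_sum fun m _ => ?_)
        rw [norm_mul, norm_pow]
        gcongr
        exact norm_sum_units_le hF hψ hW hHsq hHC (neg_ne_zero.2 ht) _
    _ ≤ 4 * (√(q ^ d))⁻¹ * √q *
        (q ^ d * (√(energy E (2 * j)) * √(energy E (2 * (j + 1))))) := by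
        rw [← mul_sum, ← hcV]
        gcongr
        exact sum_norm_polarFourier_pow_odd_le hψ hQ E j
    _ = _ := by
        have hpow : q ^ (((d : ℝ) + 1) / 2) = √(q ^ d) * √q := by
          rw [add_div, Real.rpow_add hq0, ← Real.sqrt_eq_rpow, Real.sqrt_eq_rpow (q ^ d),
            ← Real.rpow_natCast q d, ← Real.rpow_mul hq0.le, mul_one_div]
        have hqd : q ^ d = √(q ^ d) * √(q ^ d) := (Real.mul_self_sqrt (by positivity)).symm
        rw [hpow]
        nth_rewrite 2 [hqd]
        field_simp

end Fourier

/-- If `q^{(d+1)/2} Λ_{k-1}(E)^{1/2} Λ_{k+1}(E)^{1/2} = o(|E|^k)` (odd `k`), then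
`ν_k(t) = (1+o(1))|E|^k/q`. -/
theorem stmt8 (d : ℕ) (hd : 2 ≤ d) :
    ∀ ε : ℝ, 0 < ε → ∃ δ : ℝ, 0 < δ ∧ ∃ q₀ : ℕ,
      ∀ (F : Type) [Field F] [Fintype F],
        Odd (Fintype.card F) → q₀ ≤ Fintype.card F →
        ∀ Q : QuadraticForm F (Fin d → F),
          LinearMap.Nondegenerate (QuadraticMap.polarBilin Q) →
        ∀ E : Finset (Fin d → F), ∀ k : ℕ, 3 ≤ k → Odd k →
        (Fintype.card F : ℝ) ^ (((d : ℝ) + 1) / 2) *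
            (Real.sqrt (energy E (k - 1)) * Real.sqrt (energy E (k + 1))) ≤
          δ * (E.card : ℝ) ^ k →
        ∀ t : F, t ≠ 0 →
        |(nuQ Q E k t : ℝ) - (E.card : ℝ) ^ k / (Fintype.card F : ℝ)| ≤
          ε * (E.card : ℝ) ^ k / (Fintype.card F : ℝ) := by
  intro ε hε
  refine ⟨ε / 4, by positivity, 0, ?_⟩
  intro F _ _ hodd _ Q hQ E k _ hkodd hE t ht
  obtain ⟨j, rfl⟩ := hkodd
  rw [Nat.add_sub_cancel, show 2 * j + 1 + 1 = 2 * (j + 1) by ring] at hE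
  have hF : ringChar F ≠ 2 := fun h =>
    Nat.not_even_iff_odd.2 hodd (Nat.even_iff.2 (FiniteField.even_card_iff_char_two.1 h))
  let p := ringChar F
  have : Fact p.Prime := ⟨CharP.char_is_prime F p⟩
  let : Algebra (ZMod p) F := ZMod.algebra F p
  have hmain := abs_card_mul_nuQ_sub_le hF (traceChar_ne_one p F)
    (fun c hc => norm_kloosterman_le p F hc) hQ E j ht
  have hq : (0 : ℝ) < Fintype.card F := by exact_mod_cast Fintype.card_pos
  rw [le_div_iff₀ hq, ← abs_of_pos hq, ← abs_mul, abs_of_pos hq, sub_mul, div_mul_cancel₀ _ hq.ne',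
    mul_comm (nuQ _ _ _ _ : ℝ)]
  linarith
end
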